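/- arXiv:0808.1821 — 3 statements merged into one kernel-verified Lean document; each statement's English description precedes it below -/
import Mathlib

section
/- Let Φ=(f,g) be a non-affine polynomial automorphism of K^2 with deg_1(f) ≥ deg_1(g), where deg_1 is the standard homogeneous degree on K[x,y], and suppose the ideal of relations of Φ is generated by an irreducible polynomial R. Then R is of the form λ·x + μ·y^r for some λ ∈ K*, μ ∈ K and r ∈ ℕ*; in particular f̄ − c·ḡ^r = 0 for some c ∈ K. -/
open MvPolynomial

/-- Leading term of a polynomial with respect to the standard homogeneous degree. -/
noncomputable def ltStd {K : Type*} [CommSemiring K] {n : ℕ}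
    (p : MvPolynomial (Fin n) K) : MvPolynomial (Fin n) K :=
  homogeneousComponent p.totalDegree p

section Helpers

variable {K : Type*} [Field K]

/-- Weighted component. -/
noncomputable def tc (n m D : ℕ) (P : MvPolynomial (Fin 2) K) : MvPolynomial (Fin 2) K :=
  weightedHomogeneousComponent ![n, m] D P

lemma coeff_tc (n m D : ℕ) (P : MvPolynomial (Fin 2) K) (e : Fin 2 →₀ ℕ) :
    coeff e (tc n m D P) = if n * e 0 + m * e 1 = D then coeff e P else 0 := by
  unfold tc
  rw [coeff_weightedHomogeneousComponent]
  simp [Finsupp.weight_apply, Finsupp.sum_fintype, mul_comm]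

lemma hc_mul (a b : ℕ) (p q : MvPolynomial (Fin 2) K) (hp : p.totalDegree ≤ a)
    (hq : q.totalDegree ≤ b) :
    homogeneousComponent (a + b) (p * q)
      = homogeneousComponent a p * homogeneousComponent b q := by
  have key : ∀ (a : ℕ) (p : MvPolynomial (Fin 2) K), p.totalDegree ≤ a →
      ∀ e : Fin 2 →₀ ℕ, a < e.degree → coeff e p = 0 := by
    intro a p hp e he
    by_contra h
    have := le_totalDegree (mem_support_iff.mpr h)
    rw [Finsupp.degree_apply] at he
    exact absurd (lt_of_lt_of_le he this) (by omega)
  ext d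
  rw [coeff_homogeneousComponent, coeff_mul, coeff_mul]
  split_ifs with h
  · refine Finset.sum_congr rfl fun x hx => ?_
    rw [Finset.HasAntidiagonal.mem_antidiagonal] at hx
    have hd : x.1.degree + x.2.degree = a + b := by rw [← h, ← hx, map_add]
    rw [coeff_homogeneousComponent, coeff_homogeneousComponent]
    rcases lt_trichotomy x.1.degree a with h1 | h1 | h1
    · rw [key b q hq x.2 (by omega)]; simp
    · rw [if_pos h1, if_pos (by omega)]
    · rw [key a p hp x.1 h1]; simp
  · symm
    refine Finset.sum_eq_zero fun x hx => ?_
    rw [Finset.HasAntidiagonal.mem_antidiagonal] at hx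
    have hd : x.1.degree + x.2.degree ≠ a + b := by
      intro h'; apply h; rw [← h', ← hx, map_add]
    rw [coeff_homogeneousComponent, coeff_homogeneousComponent]
    by_cases h1 : x.1.degree = a
    · rw [if_neg (c := x.2.degree = b) (by omega), mul_zero]
    · rw [if_neg h1, zero_mul]

lemma hc_pow (a k : ℕ) (p : MvPolynomial (Fin 2) K) (hp : p.totalDegree ≤ a) :
    (p ^ k).totalDegree ≤ a * k ∧
    homogeneousComponent (a * k) (p ^ k) = homogeneousComponent a p ^ k := by
  induction k with
  | zero => simp [homogeneousComponent_zero]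
  | succ k ih =>
    rw [pow_succ, pow_succ, mul_add, mul_one]
    refine ⟨(totalDegree_mul _ _).trans (add_le_add ih.1 hp), ?_⟩
    rw [hc_mul _ _ _ _ ih.1 hp, ih.2]

lemma hc_aeval (n m D : ℕ) (f g P : MvPolynomial (Fin 2) K) (hf : f.totalDegree ≤ n)
    (hg : g.totalDegree ≤ m) (hP : ∀ e ∈ P.support, n * e 0 + m * e 1 ≤ D) :
    homogeneousComponent D (aeval ![f, g] P)
      = aeval ![homogeneousComponent n f, homogeneousComponent m g] (tc n m D P) := by
  have h2 : tc n m D P = ∑ e ∈ P.support,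
      if n * e 0 + m * e 1 = D then monomial e (coeff e P) else 0 := by
    ext d
    rw [coeff_tc, coeff_sum]
    conv_lhs => rw [P.as_sum, coeff_sum]
    split_ifs with h
    · refine Finset.sum_congr rfl fun x hx => ?_
      by_cases hxd : x = d
      · subst hxd; simp [h]
      · split_ifs <;> simp [coeff_monomial, hxd]
    · symm
      refine Finset.sum_eq_zero fun x hx => ?_
      by_cases hxd : x = d
      · subst hxd; simp [h]
      · split_ifs <;> simp [coeff_monomial, hxd]
  rw [h2]
  conv_lhs => rw [P.as_sum]
  simp only [map_sum]
  refine Finset.sum_congr rfl fun e he => ?_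
  have h1 := hP e he
  have hf' := hc_pow n (e 0) f hf
  have hg' := hc_pow m (e 1) g hg
  have hmon : ∀ u v : MvPolynomial (Fin 2) K, aeval ![u, v] (monomial e (coeff e P))
      = C (coeff e P) * (u ^ e 0 * v ^ e 1) := by
    intro u v
    rw [aeval_monomial, Finsupp.prod_fintype _ _ (by simp)]
    simp
  rw [hmon, homogeneousComponent_C_mul]
  split_ifs with h
  · rw [hmon, ← h, hc_mul _ _ _ _ hf'.1 hg'.1, hf'.2, hg'.2]
  · rw [homogeneousComponent_eq_zero, mul_zero, map_zero]
    exact lt_of_le_of_lt ((totalDegree_mul _ _).trans (add_le_add hf'.1 hg'.1))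
      (lt_of_le_of_ne h1 h)

/-- weight bound of the support -/
lemma exists_top (n m : ℕ) (P : MvPolynomial (Fin 2) K) (hP : P ≠ 0) :
    ∃ D, (∀ e ∈ P.support, n * e 0 + m * e 1 ≤ D) ∧ tc n m D P ≠ 0 := by
  obtain ⟨e, he, hmax⟩ := Finset.exists_max_image P.support (fun e => n * e 0 + m * e 1)
    (support_nonempty.mpr hP)
  refine ⟨_, hmax, fun h => ?_⟩
  have := congrArg (coeff e) h
  rw [coeff_tc] at this
  simp at this
  exact mem_support_iff.mp he this

lemma ker_top (n m D : ℕ) (F G P : MvPolynomial (Fin 2) K) (hF : F.IsHomogeneous n)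
    (hG : G.IsHomogeneous m) (hP : ∀ e ∈ P.support, n * e 0 + m * e 1 ≤ D)
    (h0 : aeval ![F, G] P = 0) : aeval ![F, G] (tc n m D P) = 0 := by
  have := hc_aeval n m D F G P hF.totalDegree_le hG.totalDegree_le hP
  rw [h0, map_zero, homogeneousComponent_eq_self hF, homogeneousComponent_eq_self hG] at this
  exact this.symm

lemma aeval_pair {A : Type*} [CommRing A] [Algebra K A] (u v : A) (P : MvPolynomial (Fin 2) K) :
    aeval ![u, v] P = ∑ e ∈ P.support, algebraMap K A (coeff e P) * (u ^ e 0 * v ^ e 1) := by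
  rw [aeval_def, eval₂_eq']
  simp

/-- a nonzero relation has large `y`-degree -/
lemma rel_degree (n m : ℕ) (hn : 0 < n) (hm : 0 < m) (F G P : MvPolynomial (Fin 2) K)
    (hF : F.IsHomogeneous n) (hG : G.IsHomogeneous m) (hF0 : F ≠ 0) (hG0 : G ≠ 0) (hP : P ≠ 0)
    (h0 : aeval ![F, G] P = 0) : n.lcm m ≤ m * P.degreeOf 1 := by
  obtain ⟨D, hD, hne⟩ := exists_top n m P hP
  have hk := ker_top n m D F G P hF hG hD h0
  set Q := tc n m D P with hQ
  have hQs : ∀ e ∈ Q.support, n * e 0 + m * e 1 = D ∧ e ∈ P.support := by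
    intro e he
    rw [mem_support_iff, hQ, coeff_tc] at he
    rw [mem_support_iff]
    split_ifs at he with h
    · exact ⟨h, he⟩
    · exact absurd rfl he
  obtain ⟨e, he⟩ := support_nonempty.mpr hne
  have : ∃ e' ∈ Q.support, e' ≠ e := by
    by_contra hcon
    push Not at hcon
    have hs : Q.support = {e} := by
      ext x; rw [Finset.mem_singleton]; exact ⟨hcon x, fun h => h ▸ he⟩
    rw [aeval_pair, hs, Finset.sum_singleton] at hk
    have hc := mem_support_iff.mp he
    simp [hF0, hG0, hc] at hk
  obtain ⟨e', he', hee⟩ := this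
  have h1 := hQs e he
  have h2 := hQs e' he'
  have main : ∀ a b : Fin 2 →₀ ℕ, b ∈ P.support → n * a 0 + m * a 1 = n * b 0 + m * b 1 →
      a 1 < b 1 → n.lcm m ≤ m * P.degreeOf 1 := by
    intro a b hb hab hlt
    refine le_trans ?_ (Nat.mul_le_mul_left m (monomial_le_degreeOf 1 hb))
    obtain ⟨k, hk⟩ := Nat.exists_eq_add_of_lt hlt
    have h3 : n * a 0 = n * b 0 + m * (k + 1) := by rw [hk] at hab; nlinarith
    have hdiv : n ∣ m * (k + 1) :=
      (Nat.dvd_add_right (Dvd.intro _ rfl)).mp (h3 ▸ Dvd.intro _ rfl)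
    have := Nat.le_of_dvd (by positivity) (Nat.lcm_dvd hdiv (Dvd.intro (k+1) rfl))
    refine this.trans (Nat.mul_le_mul_left m (by omega))
  rcases lt_trichotomy (e 1) (e' 1) with h | h | h
  · exact main e e' h2.2 (h1.1.trans h2.1.symm) h
  · exfalso
    apply hee
    have h3 : n * e 0 = n * e' 0 := by
      have := h1.1.trans h2.1.symm
      rw [h] at this; omega
    have h4 := Nat.eq_of_mul_eq_mul_left hn h3
    ext i; fin_cases i
    · exact h4.symm
    · exact h.symm
  · exact main e' e h1.2 (h2.1.trans h1.1.symm) h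

lemma totalDegree_pderiv_le' (i : Fin 2) (p : MvPolynomial (Fin 2) K) :
    (pderiv i p).totalDegree ≤ p.totalDegree - 1 := by
  rw [totalDegree, Finset.sup_le_iff]
  intro e he
  rw [mem_support_iff, coeff_pderiv] at he
  have h1 : e + Finsupp.single i 1 ∈ p.support := by
    rw [mem_support_iff]; intro h; rw [h] at he; simp at he
  have := le_totalDegree h1
  change Finsupp.degree (e + Finsupp.single i 1) ≤ _ at this
  rw [map_add, Finsupp.degree_single] at this
  change Finsupp.degree e ≤ _
  omega

/-- the Jacobian bracket -/
noncomputable def jac (a b : MvPolynomial (Fin 2) K) : MvPolynomial (Fin 2) K :=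
  pderiv 0 a * pderiv 1 b - pderiv 1 a * pderiv 0 b

lemma jac_chain (a f g P : MvPolynomial (Fin 2) K) :
    jac a (aeval ![f, g] P) = aeval ![f, g] (pderiv 0 P) * jac a f
      + aeval ![f, g] (pderiv 1 P) * jac a g := by
  induction P using MvPolynomial.induction_on with
  | C c => simp [jac, algebraMap_eq]
  | add p q hp hq =>
    simp only [map_add, add_mul]
    have : ∀ u v : MvPolynomial (Fin 2) K, jac a (u + v) = jac a u + jac a v := by
      intro u v; simp only [jac, map_add]; ring
    rw [this, hp, hq]; ring
  | mul_X p i hp =>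
    have : ∀ u v : MvPolynomial (Fin 2) K, jac a (u * v) = jac a u * v + u * jac a v := by
      intro u v; simp only [jac, pderiv_mul]; ring
    rw [map_mul, this, hp]
    fin_cases i <;> simp [pderiv_mul, pderiv_X] <;> ring

lemma jac_degree (a b : MvPolynomial (Fin 2) K) (h : jac a b ≠ 0) :
    (jac a b).totalDegree + 2 ≤ a.totalDegree + b.totalDegree := by
  have hz : ∀ p : MvPolynomial (Fin 2) K, p.totalDegree = 0 → ∀ i, pderiv i p = 0 := by
    intro p hp i
    rw [totalDegree_eq_zero_iff_eq_C] at hp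
    rw [hp, pderiv_C]
  have ha : a.totalDegree ≠ 0 := fun h' => h (by simp [jac, hz a h'])
  have hb : b.totalDegree ≠ 0 := fun h' => h (by simp [jac, hz b h'])
  have h1 : (jac a b).totalDegree ≤ (a.totalDegree - 1) + (b.totalDegree - 1) := by
    refine (totalDegree_sub _ _).trans (max_le ?_ ?_) <;>
    exact (totalDegree_mul _ _).trans
      (add_le_add (totalDegree_pderiv_le' _ _) (totalDegree_pderiv_le' _ _))
  omega

lemma jac_ne_zero (f g : MvPolynomial (Fin 2) K)
    (hs : Function.Surjective
      ⇑(aeval ![f, g] : MvPolynomial (Fin 2) K →ₐ[K] MvPolynomial (Fin 2) K)) :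
    jac f g ≠ 0 := by
  intro h
  have hanti : ∀ a b : MvPolynomial (Fin 2) K, jac a b = - jac b a := by
    intro a b; simp only [jac]; ring
  have hself : ∀ a : MvPolynomial (Fin 2) K, jac a a = 0 := by
    intro a; simp only [jac]; ring
  have h1 : ∀ p, jac f p = 0 := by
    intro p; obtain ⟨P, rfl⟩ := hs p
    rw [jac_chain, hself, h]; simp
  have h2 : ∀ p, jac g p = 0 := by
    intro p; obtain ⟨P, rfl⟩ := hs p
    rw [jac_chain, hself, hanti g f, h]; simp
  have h3 : jac (X 0) (X 1 : MvPolynomial (Fin 2) K) = 0 := by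
    obtain ⟨P, hP⟩ := hs (X 1)
    rw [← hP, jac_chain, hanti _ f, hanti _ g, h1, h2]; simp
  simp [jac, pderiv_X] at h3

lemma pderiv_tc (n m D : ℕ) (P : MvPolynomial (Fin 2) K) (hD : m ≤ D) :
    tc n m (D - m) (pderiv 1 P) = pderiv 1 (tc n m D P) := by
  ext e
  rw [coeff_tc, coeff_pderiv, coeff_pderiv, coeff_tc]
  have : (n * (e + Finsupp.single 1 1 : Fin 2 →₀ ℕ) 0 +
      m * (e + Finsupp.single 1 1 : Fin 2 →₀ ℕ) 1 = D) ↔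
      n * e 0 + m * e 1 = D - m := by
    simp [mul_add]; omega
  simp only [this]
  split_ifs <;> simp

lemma not_dvd_pderiv [CharZero K] (R : MvPolynomial (Fin 2) K) (hR : 0 < R.degreeOf 1) :
    ¬ R ∣ pderiv 1 R := by
  have hlt : (pderiv 1 R).degreeOf 1 < R.degreeOf 1 := by
    rw [degreeOf_lt_iff hR]
    intro e he
    rw [mem_support_iff, coeff_pderiv] at he
    have h1 : e + Finsupp.single 1 1 ∈ R.support := by
      rw [mem_support_iff]; intro h; rw [h] at he; simp at he
    have := monomial_le_degreeOf 1 h1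
    simp at this
    omega
  have hne : pderiv 1 R ≠ 0 := by
    intro h0
    have : ∃ e ∈ R.support, 0 < e 1 := by
      by_contra hcon
      push Not at hcon
      have := degreeOf_le_iff (n := (1 : Fin 2)) (f := R) (d := 0) |>.mpr hcon
      omega
    obtain ⟨e, he, he1⟩ := this
    have h2 := congrArg (coeff (e - Finsupp.single 1 1)) h0
    have h3 : e - Finsupp.single 1 1 + Finsupp.single 1 1 = e := by
      ext i; fin_cases i
      · simp
      · simp; omega
    rw [coeff_pderiv, h3, coeff_zero] at h2
    rcases mul_eq_zero.mp h2 with h | h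
    · exact mem_support_iff.mp he h
    · norm_cast at h
  rintro ⟨T, hT⟩
  have hR0 : R ≠ 0 := by rintro rfl; simp at hR
  have hT0 : T ≠ 0 := by rintro rfl; simp at hT; exact hne hT
  rw [hT, degreeOf_mul_eq hR0 hT0] at hlt
  omega


lemma parachute [CharZero K] (f g R : MvPolynomial (Fin 2) K)
    (hbij : Function.Bijective
      ⇑(aeval ![f, g] : MvPolynomial (Fin 2) K →ₐ[K] MvPolynomial (Fin 2) K))
    (n m : ℕ) (hn : f.totalDegree = n) (hm : g.totalDegree = m) (hn2 : 2 ≤ n)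
    (hRp : Prime R) (hRdeg : 0 < R.degreeOf 1)
    (hker : ∀ P, aeval ![ltStd f, ltStd g] P = 0 → R ∣ P) :
    ∀ (q : ℕ) (G : MvPolynomial (Fin 2) K) (D : ℕ) (H : MvPolynomial (Fin 2) K),
      (∀ e ∈ G.support, n * e 0 + m * e 1 ≤ D) → tc n m D G = R ^ q * H → ¬ R ∣ H →
      D ≤ (aeval ![f, g] G).totalDegree + q * (n + m - 2) := by
  intro q
  induction q with
  | zero =>
    intro G D H hD hG hH
    by_contra hlt
    have h1 := hc_aeval n m D f g G hn.le hm.le hD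
    rw [homogeneousComponent_eq_zero _ _ (by omega)] at h1
    apply hH
    apply hker
    rw [pow_zero, one_mul] at hG
    rw [← hG, h1]
    simp [ltStd, hn, hm]
  | succ q ih =>
    intro G D H hD hG hH
    by_cases hmD : m ≤ D
    · have hG' : tc n m (D - m) (pderiv 1 G)
          = R ^ q * (((q + 1 : ℕ) : MvPolynomial (Fin 2) K) * (pderiv 1 R * H)
            + R * pderiv 1 H) := by
        rw [pderiv_tc n m D G hmD, hG, pderiv_mul, pderiv_pow]
        simp only [Nat.add_sub_cancel]
        ring
      have hnd : ¬ R ∣ (((q + 1 : ℕ) : MvPolynomial (Fin 2) K) * (pderiv 1 R * H)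
            + R * pderiv 1 H) := by
        intro h
        rw [dvd_add_left (Dvd.intro _ rfl)] at h
        rcases hRp.dvd_or_dvd h with h | h
        · apply hRp.not_isUnit
          refine isUnit_of_dvd_unit h ?_
          have : ((q + 1 : ℕ) : MvPolynomial (Fin 2) K) = C ((q + 1 : ℕ) : K) := by simp
          rw [this]
          exact (isUnit_iff_ne_zero.mpr (by exact_mod_cast Nat.succ_ne_zero q)).map C
        · rcases hRp.dvd_or_dvd h with h | h
          · exact not_dvd_pderiv R hRdeg h
          · exact hH h
      have hD' : ∀ e ∈ (pderiv 1 G).support, n * e 0 + m * e 1 ≤ D - m := by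
        intro e he
        rw [mem_support_iff, coeff_pderiv] at he
        have h1 : e + Finsupp.single 1 1 ∈ G.support := by
          rw [mem_support_iff]; intro h; rw [h] at he; simp at he
        have := hD _ h1
        simp [mul_add] at this
        omega
      have h1 := ih (pderiv 1 G) (D - m) _ hD' hG' hnd
      have hne : pderiv 1 G ≠ 0 := by
        intro h0
        rw [h0] at hG'
        have : tc n m (D - m) (0 : MvPolynomial (Fin 2) K) = 0 := by simp [tc]
        rw [this] at hG'
        rcases mul_eq_zero.mp hG'.symm with h | h
        · exact hRp.ne_zero (by by_contra h'; exact pow_ne_zero q h' h)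
        · exact hnd (h ▸ dvd_zero R)
      have hphi : aeval ![f, g] (pderiv 1 G) ≠ 0 := by
        intro h0
        exact hne (hbij.1 (h0.trans (map_zero _).symm))
      have hJ := jac_ne_zero f g hbij.2
      have hch := jac_chain f f g G
      have hself : jac f f = 0 := by simp only [jac]; ring
      rw [hself, mul_zero, zero_add] at hch
      have hjd := jac_degree f (aeval ![f, g] G) (by rw [hch]; exact mul_ne_zero hphi hJ)
      rw [hch, totalDegree_mul_of_isDomain hphi hJ, hn] at hjd
      rw [add_mul]
      omega
    · rw [add_mul]
      omega

lemma deg_dvd [CharZero K] (f g R : MvPolynomial (Fin 2) K)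
    (hbij : Function.Bijective
      ⇑(aeval ![f, g] : MvPolynomial (Fin 2) K →ₐ[K] MvPolynomial (Fin 2) K))
    (n m : ℕ) (hn : f.totalDegree = n) (hm : g.totalDegree = m) (hmn : m ≤ n)
    (hRp : Prime R) (hm0 : 0 < m)
    (hdeg : n.lcm m ≤ m * R.degreeOf 1)
    (hker : ∀ P, aeval ![ltStd f, ltStd g] P = 0 → R ∣ P) : m ∣ n := by
  by_contra hndvd
  have hm2 : 2 ≤ m := by
    rcases Nat.lt_or_ge m 2 with h | h
    · exact absurd (by rw [show m = 1 by omega]; exact one_dvd n) hndvd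
    · exact h
  have hL : 2 * n ≤ n.lcm m := by
    obtain ⟨k, hk⟩ := Nat.dvd_lcm_left n m
    have hmd := Nat.dvd_lcm_right n m
    have hpos := Nat.lcm_pos (by omega : 0 < n) hm0
    rcases k with _ | _ | k
    · omega
    · rw [hk] at hmd; simp at hmd; exact absurd hmd hndvd
    · rw [hk]; nlinarith
  have hRdeg : 0 < R.degreeOf 1 := by
    rcases Nat.eq_zero_or_pos (R.degreeOf 1) with h | h
    · rw [h] at hdeg; omega
    · exact h
  obtain ⟨G, hG⟩ := hbij.2 (X 0)
  have hG0 : G ≠ 0 := by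
    rintro rfl; rw [map_zero] at hG; exact X_ne_zero _ hG.symm
  obtain ⟨D, hD, hT⟩ := exists_top n m G hG0
  obtain ⟨q, H, hH, hTq⟩ := WfDvdMonoid.max_power_factor hT hRp.irreducible
  have h1 := parachute f g R hbij n m hn hm (by omega) hRp hRdeg hker q G D H hD hTq hH
  rw [hG, totalDegree_X] at h1
  have hH0 : H ≠ 0 := fun h => hH (h ▸ dvd_zero R)
  have h2 : m * (tc n m D G).degreeOf 1 ≤ D := by
    have : (tc n m D G).degreeOf 1 ≤ D / m := by
      rw [degreeOf_le_iff]
      intro e he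
      rw [mem_support_iff, coeff_tc] at he
      split_ifs at he with h
      · rw [Nat.le_div_iff_mul_le hm0, ← h, mul_comm]; exact Nat.le_add_left _ _
      · exact absurd rfl he
    exact (Nat.mul_le_mul_left m this).trans (Nat.mul_div_le D m)
  rw [hTq, degreeOf_mul_eq (pow_ne_zero _ hRp.ne_zero) hH0,
    degreeOf_pow_eq _ _ _ hRp.ne_zero] at h2
  have h3 : q * (2 * n) ≤ D := by
    refine le_trans ?_ h2
    calc q * (2 * n) ≤ q * (m * R.degreeOf 1) := Nat.mul_le_mul_left q (hL.trans hdeg)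
      _ ≤ _ := by nlinarith [Nat.zero_le (m * H.degreeOf 1)]
  rcases Nat.eq_zero_or_pos q with hq | hq
  · subst hq
    have h4 : G.totalDegree = 0 := by
      rw [← Nat.le_zero, totalDegree, Finset.sup_le_iff]
      intro e he
      have h5 := hD e he
      have h6 : e 0 = 0 := by
        by_contra h; have : 1 ≤ e 0 := by omega
        nlinarith
      have h7 : e 1 = 0 := by
        by_contra h; have : 1 ≤ e 1 := by omega
        nlinarith
      rw [Finsupp.sum_fintype _ _ (by simp)]
      simp [h6, h7]
    rw [totalDegree_eq_zero_iff_eq_C] at h4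
    rw [h4] at hG
    have h8 := congrArg totalDegree hG
    simp [algebraMap_eq] at h8
  · have h4 : n + m - 2 + 2 ≤ 2 * n := by omega
    have h5 : q * (n + m - 2) + q * 2 ≤ q * (2 * n) := by
      rw [← mul_add]; exact Nat.mul_le_mul_left q h4
    omega

lemma irred_S (c : K) (r : ℕ) :
    Irreducible (X 0 - C c * X 1 ^ r : MvPolynomial (Fin 2) K) := by
  let φ : MvPolynomial (Fin 2) K ≃ₐ[K] MvPolynomial (Fin 2) K :=
    AlgEquiv.ofAlgHom (aeval ![X 0 - C c * X 1 ^ r, X 1]) (aeval ![X 0 + C c * X 1 ^ r, X 1])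
      (by ext i; fin_cases i <;> simp [algebraMap_eq])
      (by ext i; fin_cases i <;> simp [algebraMap_eq])
  have h : φ (X 0) = X 0 - C c * X 1 ^ r := by simp [φ]
  rw [← h, MulEquiv.irreducible_iff]
  exact (X_prime (i := 0)).irreducible

/-- in the divisible case leading terms are proportional -/
lemma lt_eq [IsAlgClosed K] (L : Type*) [Field L] [Algebra K L]
    [Algebra (MvPolynomial (Fin 2) K) L] [IsScalarTower K (MvPolynomial (Fin 2) K) L]
    [IsFractionRing (MvPolynomial (Fin 2) K) L] (r m : ℕ) (hm : 0 < m) (F G P : MvPolynomial (Fin 2) K)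
    (hF : F.IsHomogeneous (m * r)) (hG : G.IsHomogeneous m) (hG0 : G ≠ 0)
    (hP : P ≠ 0) (h0 : aeval ![F, G] P = 0) : ∃ c : K, F = C c * G ^ r := by
  obtain ⟨D, hD, hne⟩ := exists_top (m * r) m P hP
  have hk := ker_top (m * r) m D F G P hF hG hD h0
  set Q := tc (m * r) m D P with hQ
  have hQs : ∀ e ∈ Q.support, r * e 0 + e 1 = D / m := by
    intro e he
    rw [mem_support_iff, hQ, coeff_tc] at he
    split_ifs at he with h
    · rw [← h, mul_assoc, ← mul_add, Nat.mul_div_cancel_left _ hm]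
    · exact absurd rfl he
  let ι := algebraMap (MvPolynomial (Fin 2) K) L
  have hinj : Function.Injective ι := IsFractionRing.injective _ L
  have hGL : ι G ≠ 0 := by
    intro h; exact hG0 (hinj (h.trans (map_zero _).symm))
  let z : L := ι F / ι G ^ r
  have hz : ι F = z * ι G ^ r := by
    simp only [z]; field_simp
  let p : Polynomial K := ∑ e ∈ Q.support, Polynomial.C (coeff e Q) * Polynomial.X ^ (e 0)
  have hp0 : p ≠ 0 := by
    obtain ⟨e, he⟩ := support_nonempty.mpr hne
    intro h
    have h1 := congrArg (fun t => Polynomial.coeff t (e 0)) h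
    simp only [p, Polynomial.finsetSum_coeff, Polynomial.coeff_C_mul_X_pow,
      Polynomial.coeff_zero] at h1
    rw [Finset.sum_eq_single e] at h1
    · simp at h1; exact mem_support_iff.mp he h1
    · intro b hb hbe
      rw [if_neg]
      intro hh
      apply hbe
      have ha := hQs e he
      have hb := hQs b hb
      rw [← hh] at hb
      ext i; fin_cases i
      · exact hh.symm
      · simp; omega
    · intro h; exact absurd he h
  have hpz : Polynomial.aeval z p = 0 := by
    have h1 := congrArg ι hk
    rw [aeval_pair, map_sum, map_zero] at h1
    have h2 : Polynomial.aeval z p * ι G ^ (D / m) = 0 := by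
      rw [← h1]
      simp only [p, map_sum, Finset.sum_mul]
      refine Finset.sum_congr rfl fun e he => ?_
      rw [map_mul, map_mul, map_mul, map_pow, map_pow, map_pow, hz, Polynomial.aeval_C,
        Polynomial.aeval_X, ← IsScalarTower.algebraMap_apply K (MvPolynomial (Fin 2) K) L,
        ← hQs e he]
      ring
    exact (mul_eq_zero.mp h2).resolve_right (pow_ne_zero _ hGL)
  have halg : IsIntegral K z := isAlgebraic_iff_isIntegral.mp ⟨p, hp0, hpz⟩
  obtain ⟨c, hc⟩ := minpoly.mem_range_of_degree_eq_one K z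
    (IsAlgClosed.degree_eq_one_of_irreducible K (minpoly.irreducible halg))
  refine ⟨c, hinj ?_⟩
  rw [hz, ← hc, map_mul, map_pow, IsScalarTower.algebraMap_apply K (MvPolynomial (Fin 2) K) L]
  rfl

end Helpers

/-- Assertion (*) in the proofs of the Jung–van der Kulk theorem: for a non-affine
automorphism `(f,g)` of `K²` with `deg f ≥ deg g` whose ideal of relations is generated
by an irreducible `R`, the generator has the form `λ·x + μ·y^r`; in particular
`f̄ - c·ḡ^r = 0` for some constant `c`. -/
theorem stmt5 {K : Type*} [Field K] [IsAlgClosed K] [CharZero K]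
    (f g : MvPolynomial (Fin 2) K)
    (hf : Function.Bijective
      ⇑(aeval ![f, g] : MvPolynomial (Fin 2) K →ₐ[K] MvPolynomial (Fin 2) K))
    (hnonaff : ¬(f.totalDegree ≤ 1 ∧ g.totalDegree ≤ 1))
    (hdeg : g.totalDegree ≤ f.totalDegree)
    (R : MvPolynomial (Fin 2) K) (hirr : Irreducible R)
    (hI : RingHom.ker
        (aeval ![ltStd f, ltStd g] : MvPolynomial (Fin 2) K →ₐ[K] MvPolynomial (Fin 2) K)
      = Ideal.span {R}) :
    ∃ (lam mu : K) (r : ℕ), lam ≠ 0 ∧ 1 ≤ r ∧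
      R = C lam * X 0 + C mu * X 1 ^ r ∧
      ∃ c : K, ltStd f - C c * ltStd g ^ r = 0 := by

  classical
  set n := f.totalDegree with hn
  set m := g.totalDegree with hm
  have hRp : Prime R := hirr.prime
  have hker : ∀ P, aeval ![ltStd f, ltStd g] P = 0 ↔ R ∣ P := by
    intro P
    rw [← Ideal.mem_span_singleton, ← hI, RingHom.mem_ker]
  have hm0 : 0 < m := by
    rw [Nat.pos_iff_ne_zero]
    intro h
    rw [hm, totalDegree_eq_zero_iff_eq_C] at h
    have h1 : aeval ![f, g] (X 1 : MvPolynomial (Fin 2) K)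
        = aeval ![f, g] (C (coeff 0 g) : MvPolynomial (Fin 2) K) := by
      simpa [algebraMap_eq] using h
    have h2 := congrArg totalDegree (hf.1 h1)
    simp at h2
  have hn0 : 0 < n := lt_of_lt_of_le hm0 hdeg
  have hlt : ∀ p : MvPolynomial (Fin 2) K, 0 < p.totalDegree → ltStd p ≠ 0 := by
    intro p hp h
    have hp0 : p ≠ 0 := by rintro rfl; simp at hp
    obtain ⟨e, he, hmax⟩ := Finset.exists_mem_eq_sup p.support (support_nonempty.mpr hp0)
      (fun s => s.sum fun _ e => e)
    have h1 := congrArg (coeff e) h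
    rw [ltStd, coeff_homogeneousComponent, if_pos, coeff_zero] at h1
    · exact mem_support_iff.mp he h1
    · exact hmax.symm
  have hF0 := hlt f hn0
  have hG0 := hlt g hm0
  have hFh : (ltStd f).IsHomogeneous n := homogeneousComponent_isHomogeneous _ _
  have hGh : (ltStd g).IsHomogeneous m := homogeneousComponent_isHomogeneous _ _
  have hR0 := (hker R).mpr dvd_rfl
  have hdR := rel_degree n m hn0 hm0 _ _ R hFh hGh hF0 hG0 hRp.ne_zero hR0
  obtain ⟨r, hr⟩ := deg_dvd f g R hf n m rfl rfl hdeg hRp hm0 hdR (fun P => (hker P).mp)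
  rw [hr] at hFh
  obtain ⟨c, hc⟩ := lt_eq (FractionRing (MvPolynomial (Fin 2) K)) r m hm0 _ _ R hFh hGh hG0 hRp.ne_zero hR0
  have hRS : R ∣ X 0 - C c * X 1 ^ r := by
    rw [← hker]; simp [algebraMap_eq, ← hc]
  obtain ⟨u, hu⟩ := ((hirr.dvd_irreducible_iff_associated (irred_S c r)).mp hRS).symm
  obtain ⟨a, ha, hau⟩ := isUnit_iff_eq_C_of_isReduced.mp u.isUnit
  refine ⟨a, -(a * c), r, ha.ne_zero, ?_, ?_, c, ?_⟩
  · rcases Nat.eq_zero_or_pos r with h | h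
    · rw [h] at hr; omega
    · exact h
  · rw [← hu, hau]; simp only [map_neg, map_mul]; ring
  · rw [sub_eq_zero]; exact hc
end

section
/- Let Φ=(f_1,…,f_n) be a polynomial automorphism of K^n, deg_1 the standard homogeneous degree, deg_2 the weighted degree with weights d_i = deg_1(f_i), and ∇ = d_1 + ⋯ + d_n − n. Suppose the ideal of relations is I = (R) with R irreducible and ∂R/∂x_n ≠ 0. Let P ∈ K[x_1,…,x_n] be nonzero and k ∈ ℕ be such that P̃ ∈ (R^k) and P̃ ∉ (R^{k+1}). Then: (i) deg_1((∂^k P/∂x_n^k)∘Φ) = deg_2(∂^k P/∂x_n^k) = deg_2(P) − k·d_n; (ii) deg_1(P∘Φ) ≥ deg_2(P) − k·∇; (iii) deg_1(P∘Φ) ≥ k·(deg_2(R) − ∇). -/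
open MvPolynomial

/-- Leading term of a polynomial with respect to the weighted homogeneous degree
with weights `w`. -/
noncomputable def ldt {K : Type*} [CommSemiring K] {n : ℕ} (w : Fin n → ℕ)
    (p : MvPolynomial (Fin n) K) : MvPolynomial (Fin n) K :=
  weightedHomogeneousComponent w (weightedTotalDegree w p) p

/-- The ideal of relations between the leading terms (for the standard degree) of the
components of an automorphism. -/
noncomputable def relIdealStd {K : Type*} [CommRing K] {n : ℕ}
    (f : Fin n → MvPolynomial (Fin n) K) : Ideal (MvPolynomial (Fin n) K) :=
  RingHom.ker
    (aeval (fun i => ltStd (f i)) : MvPolynomial (Fin n) K →ₐ[K] MvPolynomial (Fin n) K)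

/-- `p` has `w`-degree at most `a`, and its component of degree `a` is `P`. -/
def HasLead {K : Type*} [Field K] {σ : Type*} (w : σ → ℕ)
    (p : MvPolynomial σ K) (a : ℕ) (P : MvPolynomial σ K) : Prop :=
  (∀ m, coeff m p ≠ 0 → Finsupp.weight w m ≤ a) ∧ weightedHomogeneousComponent w a p = P

section helpers

variable {K : Type*} [Field K] {σ : Type*} {w : σ → ℕ}

lemma HasLead.mul {p q P Q : MvPolynomial σ K} {a b : ℕ}
    (hp : HasLead w p a P) (hq : HasLead w q b Q) : HasLead w (p * q) (a + b) (P * Q) := by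
  classical
  obtain ⟨hp, rfl⟩ := hp
  obtain ⟨hq, rfl⟩ := hq
  constructor
  · intro m hm
    rw [coeff_mul] at hm
    obtain ⟨x, hx, hne⟩ := Finset.exists_ne_zero_of_sum_ne_zero hm
    rw [Finset.HasAntidiagonal.mem_antidiagonal] at hx
    rw [← hx, map_add]
    exact add_le_add (hp _ (left_ne_zero_of_mul hne)) (hq _ (right_ne_zero_of_mul hne))
  · ext m
    rw [coeff_weightedHomogeneousComponent, coeff_mul, coeff_mul]
    simp only [coeff_weightedHomogeneousComponent]
    split_ifs with h
    · refine Finset.sum_congr rfl fun x hx => ?_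
      rw [Finset.HasAntidiagonal.mem_antidiagonal] at hx
      rw [← hx, map_add] at h
      by_cases h1 : coeff x.1 p = 0
      · simp [h1]
      by_cases h2 : coeff x.2 q = 0
      · simp [h2]
      have := hp _ h1
      have := hq _ h2
      rw [if_pos (by omega), if_pos (by omega)]
    · symm
      refine Finset.sum_eq_zero fun x hx => ?_
      rw [Finset.HasAntidiagonal.mem_antidiagonal] at hx
      rw [← hx, map_add] at h
      split_ifs with h1 h2
      · exact absurd (by rw [h1, h2]) h
      all_goals simp

lemma HasLead.const (c : K) : HasLead w (C c) 0 (C c) := by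
  classical
  refine ⟨?_, weightedHomogeneousComponent_eq_self (isWeightedHomogeneous_C w c)⟩
  intro m hm
  rw [isWeightedHomogeneous_C w c hm]

lemma HasLead.pow {p P : MvPolynomial σ K} {a : ℕ}
    (hp : HasLead w p a P) (k : ℕ) : HasLead w (p ^ k) (k * a) (P ^ k) := by
  induction k with
  | zero => simpa using HasLead.const (w := w) (1 : K)
  | succ k ih => rw [pow_succ, pow_succ, add_mul, one_mul]; exact ih.mul hp

lemma HasLead.prod {ι : Type*} (s : Finset ι) {p P : ι → MvPolynomial σ K} {a : ι → ℕ}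
    (hp : ∀ i, HasLead w (p i) (a i) (P i)) :
    HasLead w (∏ i ∈ s, p i) (∑ i ∈ s, a i) (∏ i ∈ s, P i) := by
  classical
  induction s using Finset.induction_on with
  | empty => simpa using HasLead.const (w := w) (1 : K)
  | insert i s hi ih =>
    rw [Finset.prod_insert hi, Finset.prod_insert hi, Finset.sum_insert hi]
    exact (hp i).mul ih

lemma HasLead.sum {ι : Type*} (s : Finset ι) {p P : ι → MvPolynomial σ K} {a : ℕ}
    (hp : ∀ i ∈ s, HasLead w (p i) a (P i)) :
    HasLead w (∑ i ∈ s, p i) a (∑ i ∈ s, P i) := by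
  constructor
  · intro m hm
    rw [coeff_sum] at hm
    obtain ⟨x, hx, hne⟩ := Finset.exists_ne_zero_of_sum_ne_zero hm
    exact (hp x hx).1 m hne
  · rw [map_sum]
    exact Finset.sum_congr rfl fun i hi => (hp i hi).2

lemma HasLead.lt {p P : MvPolynomial σ K} {a b : ℕ} (hp : HasLead w p a P) (h : a < b) :
    HasLead w p b 0 := by
  refine ⟨fun m hm => (hp.1 m hm).trans h.le, weightedHomogeneousComponent_eq_zero' _ _ ?_⟩
  intro m hm
  have := hp.1 m (mem_support_iff.1 hm)
  omega

lemma hasLead_of_le {p : MvPolynomial σ K} {a : ℕ} (h : weightedTotalDegree w p ≤ a) :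
    HasLead w p a (weightedHomogeneousComponent w a p) :=
  ⟨fun _ hm => (le_weightedTotalDegree w (mem_support_iff.2 hm)).trans h, rfl⟩

lemma HasLead.eq {p P : MvPolynomial σ K} {a : ℕ} (h : HasLead w p a P) (hP : P ≠ 0) :
    weightedTotalDegree w p = a := by
  apply le_antisymm
  · exact Finset.sup_le fun m hm => h.1 m (mem_support_iff.1 hm)
  · by_contra hlt
    exact hP (h.2 ▸ weightedHomogeneousComponent_eq_zero _ _ (not_le.1 hlt))

lemma lead_ne_zero {p : MvPolynomial σ K} (hp : p ≠ 0) :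
    weightedHomogeneousComponent w (weightedTotalDegree w p) p ≠ 0 := by
  classical
  have hs : p.support.Nonempty := by rwa [Finset.nonempty_iff_ne_empty, Ne, support_eq_empty]
  obtain ⟨m, hm, he⟩ := Finset.exists_mem_eq_sup _ hs (fun s => Finsupp.weight w s)
  intro h0
  have := congrArg (coeff m) h0
  rw [coeff_weightedHomogeneousComponent, if_pos (by rw [← he]; rfl)] at this
  exact mem_support_iff.1 hm (by simpa using this)

lemma wdeg_mul {p q : MvPolynomial σ K} (hp : p ≠ 0) (hq : q ≠ 0) :
    weightedTotalDegree w (p * q) = weightedTotalDegree w p + weightedTotalDegree w q :=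
  ((hasLead_of_le le_rfl).mul (hasLead_of_le le_rfl)).eq
    (mul_ne_zero (lead_ne_zero hp) (lead_ne_zero hq))

lemma wdeg_pow {p : MvPolynomial σ K} (hp : p ≠ 0) (k : ℕ) :
    weightedTotalDegree w (p ^ k) = k * weightedTotalDegree w p :=
  ((hasLead_of_le le_rfl).pow k).eq (pow_ne_zero _ (lead_ne_zero hp))

lemma HasLead.aeval {τ : Type*} {f F : σ → MvPolynomial τ K} {v : τ → ℕ}
    (hf : ∀ i, HasLead v (f i) (w i) (F i)) {Q : MvPolynomial σ K} {M : ℕ}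
    {Q' : MvPolynomial σ K} (hQ : HasLead w Q M Q') :
    HasLead v (MvPolynomial.aeval f Q) M (MvPolynomial.aeval F Q') := by
  classical
  obtain ⟨hQ, rfl⟩ := hQ
  have hmon : ∀ (m : σ →₀ ℕ) (c : K), Finsupp.weight w m ≤ M → HasLead v (MvPolynomial.aeval f (monomial m c)) M
      (MvPolynomial.aeval F (weightedHomogeneousComponent w M (monomial m c))) := by
    intro m c hm
    have key : HasLead v (MvPolynomial.aeval f (monomial m c)) (Finsupp.weight w m)
        (MvPolynomial.aeval F (monomial m c)) := by
      rw [aeval_monomial, aeval_monomial, Finsupp.weight_apply]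
      have h1 := (HasLead.const (w := v) c).mul
        (HasLead.prod m.support (fun i => (hf i).pow (m i)))
      rw [zero_add] at h1
      exact h1
    rcases hm.lt_or_eq with h | h
    · rw [(isWeightedHomogeneous_monomial w m c rfl).weightedHomogeneousComponent_ne _ h.ne',
        map_zero]
      exact key.lt h
    · rw [weightedHomogeneousComponent_eq_self (isWeightedHomogeneous_monomial w m c h)]
      rw [← h]
      exact key
  have h2 := HasLead.sum Q.support (fun m hm => hmon m (coeff m Q) (hQ m (mem_support_iff.1 hm)))
  rw [← map_sum, ← map_sum, ← map_sum, ← as_sum] at h2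
  exact h2

lemma HasLead.pderiv {p P : MvPolynomial σ K} {a : ℕ} (i : σ) (h : HasLead w p (a + w i) P) :
    HasLead w (pderiv i p) a (pderiv i P) := by
  classical
  obtain ⟨h, rfl⟩ := h
  have hw : ∀ m : σ →₀ ℕ, Finsupp.weight w (m + Finsupp.single i 1) = Finsupp.weight w m + w i := by
    intro m
    rw [map_add, Finsupp.weight_single, one_smul]
  constructor
  · intro m hm
    rw [coeff_pderiv] at hm
    have := h _ (left_ne_zero_of_mul hm)
    rw [hw] at this
    omega
  · ext m
    rw [coeff_weightedHomogeneousComponent, coeff_pderiv, coeff_pderiv,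
      coeff_weightedHomogeneousComponent, hw]
    by_cases h : Finsupp.weight w m = a
    · rw [if_pos h, if_pos (by omega)]
    · rw [if_neg h, if_neg (by omega), zero_mul]

lemma HasLead.pderiv_iter {p P : MvPolynomial σ K} {a : ℕ} (i : σ) (k : ℕ)
    (h : HasLead w p (a + k * w i) P) :
    HasLead w ((⇑(MvPolynomial.pderiv i))^[k] p) a ((⇑(MvPolynomial.pderiv i))^[k] P) := by
  induction k generalizing p P with
  | zero => simpa using h
  | succ k ih =>
    rw [Function.iterate_succ_apply, Function.iterate_succ_apply]
    apply ih
    apply HasLead.pderiv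
    convert h using 1
    ring

lemma wdeg_pderiv {p : MvPolynomial σ K} (i : σ) (h : pderiv i p ≠ 0) :
    weightedTotalDegree w (pderiv i p) + w i ≤ weightedTotalDegree w p := by
  classical
  have hs : (pderiv i p).support.Nonempty := by
    rwa [Finset.nonempty_iff_ne_empty, Ne, support_eq_empty]
  obtain ⟨m, hm, he⟩ := Finset.exists_mem_eq_sup _ hs (fun s => Finsupp.weight w s)
  rw [weightedTotalDegree, he]
  rw [mem_support_iff, coeff_pderiv] at hm
  have := le_weightedTotalDegree w (mem_support_iff.2 (left_ne_zero_of_mul hm))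
  rwa [map_add, Finsupp.weight_single, one_smul] at this

lemma wdeg_pderiv_iter {p : MvPolynomial σ K} (i : σ) (k : ℕ)
    (h : (⇑(pderiv i))^[k] p ≠ 0) :
    weightedTotalDegree w ((⇑(pderiv i))^[k] p) + k * w i ≤ weightedTotalDegree w p := by
  induction k with
  | zero => simp
  | succ k ih =>
    rw [Function.iterate_succ_apply'] at h ⊢
    have h1 := wdeg_pderiv (w := w) i h
    have h2 := ih (fun h0 => h (by rw [h0, map_zero]))
    rw [add_mul]
    omega

lemma tdeg_pderiv {p : MvPolynomial σ K} (i : σ) (h : pderiv i p ≠ 0) :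
    (pderiv i p).totalDegree + 1 ≤ p.totalDegree := by
  have := wdeg_pderiv (w := 1) i h
  rwa [weightedTotalDegree_one, weightedTotalDegree_one] at this

lemma iter_not_dvd [CharZero K] {R : MvPolynomial σ K} (hR : Prime R) (i : σ)
    (hdR : pderiv i R ≠ 0) (k : ℕ) (S : MvPolynomial σ K) (hS : ¬ R ∣ S) :
    ¬ R ∣ (⇑(pderiv i))^[k] (R ^ k * S) := by
  induction k generalizing S with
  | zero => simpa using hS
  | succ k ih =>
    rw [Function.iterate_succ_apply]
    have e : pderiv i (R ^ (k + 1) * S)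
        = R ^ k * (C ((k : K) + 1) * (pderiv i R * S) + R * pderiv i S) := by
      rw [pderiv_mul, pderiv_pow]
      simp only [Nat.add_sub_cancel, map_add, map_natCast, map_one]
      push_cast
      ring
    rw [e]
    apply ih
    rw [dvd_add_left (dvd_mul_right _ _)]
    intro h
    rcases hR.dvd_or_dvd h with h | h
    · have hc : ((k : K) + 1) ≠ 0 := by exact_mod_cast Nat.succ_ne_zero k
      exact hR.not_isUnit (isUnit_of_dvd_unit h ((IsUnit.mk0 _ hc).map C))
    rcases hR.dvd_or_dvd h with h | h
    · have h1 := totalDegree_le_of_dvd_of_isDomain h hdR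
      have h2 := tdeg_pderiv i hdR
      omega
    · exact hS h

lemma pderiv_aeval_chain [Fintype σ] (f : σ → MvPolynomial σ K) (j : σ) (P : MvPolynomial σ K) :
    pderiv j (aeval f P) = ∑ l, aeval f (pderiv l P) * pderiv j (f l) := by
  classical
  induction P using MvPolynomial.induction_on with
  | C a => simp [algebraMap_eq]
  | add p q hp hq => simp only [map_add, hp, hq, add_mul, Finset.sum_add_distrib]
  | mul_X p i hp =>
    rw [map_mul, pderiv_mul, hp, aeval_X, Finset.sum_mul]
    have : ∀ l, aeval f (pderiv l (p * X i)) * pderiv j (f l)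
        = aeval f (pderiv l p) * pderiv j (f l) * f i
          + (if l = i then aeval f p * pderiv j (f i) else 0) := by
      intro l
      rw [pderiv_mul, pderiv_X, map_add, map_mul, map_mul, aeval_X]
      by_cases h : l = i
      · subst h; simp; ring
      · have h' : i ≠ l := fun e => h e.symm
        simp [h, h']; ring
    simp only [this, Finset.sum_add_distrib, Finset.sum_ite_eq', Finset.mem_univ, if_true]

lemma tdeg_det [Fintype σ] [DecidableEq σ] (M : Matrix σ σ (MvPolynomial σ K)) (e : σ → ℕ)
    (h : ∀ i j, M i j ≠ 0 → (M i j).totalDegree + 1 ≤ e i) (hM : M.det ≠ 0) :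
    M.det.totalDegree + Fintype.card σ ≤ ∑ i, e i := by
  have he : ∀ i, 1 ≤ e i := by
    intro i
    by_contra hi
    apply hM
    apply Matrix.det_eq_zero_of_row_eq_zero i
    intro j
    by_contra hj
    have := h i j hj
    omega
  have hle : ∀ i j, (M i j).totalDegree ≤ e i - 1 := by
    intro i j
    by_cases hj : M i j = 0
    · simp [hj]
    · have := h i j hj
      omega
  have hdet : M.det.totalDegree ≤ ∑ i, (e i - 1) := by
    rw [← Matrix.det_transpose, Matrix.det_apply]
    apply totalDegree_finsetSum_le
    intro s _
    refine (totalDegree_smul_le _ _).trans ?_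
    refine (totalDegree_finsetProd _ _).trans ?_
    exact Finset.sum_le_sum fun i _ => hle i (s i)
  have hs : ∑ i, (e i - 1) + Fintype.card σ = ∑ i, e i := by
    rw [Fintype.card, Finset.card_eq_sum_ones, ← Finset.sum_add_distrib]
    exact Finset.sum_congr rfl fun i _ => Nat.sub_add_cancel (he i)
  omega

lemma jac_ne_zero_s16 [Fintype σ] [DecidableEq σ] (f : σ → MvPolynomial σ K)
    (hf : Function.Surjective ⇑(aeval f : MvPolynomial σ K →ₐ[K] MvPolynomial σ K)) :
    (Matrix.of fun i j => pderiv j (f i)).det ≠ 0 := by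
  choose g hg using fun i => hf (X i)
  have h : (Matrix.of fun i l => aeval f (pderiv l (g i))) *
      (Matrix.of fun i j => pderiv j (f i)) = 1 := by
    ext1 i j
    rw [Matrix.mul_apply]
    simp only [Matrix.of_apply]
    rw [← pderiv_aeval_chain, hg, pderiv_X, Matrix.one_apply, Pi.single_apply]
  intro h0
  have := congrArg Matrix.det h
  rw [Matrix.det_mul, h0, mul_zero, Matrix.det_one] at this
  exact zero_ne_one this

lemma tdeg_step [Fintype σ] [DecidableEq σ] (f : σ → MvPolynomial σ K)
    (hf : Function.Bijective ⇑(aeval f : MvPolynomial σ K →ₐ[K] MvPolynomial σ K))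
    (i : σ) (P : MvPolynomial σ K) (hP : pderiv i P ≠ 0) :
    (aeval f (pderiv i P)).totalDegree + (f i).totalDegree + Fintype.card σ
      ≤ (aeval f P).totalDegree + ∑ l, (f l).totalDegree := by
  set J : Matrix σ σ (MvPolynomial σ K) := Matrix.of fun i j => pderiv j (f i) with hJ
  have hJ0 : J.det ≠ 0 := jac_ne_zero_s16 f hf.2
  have hdet := Matrix.det_updateRow_sum J i (fun l => aeval f (pderiv l P))
  have hrow : (∑ l, (aeval f (pderiv l P)) • J l) = fun j => pderiv j (aeval f P) := by
    ext1 j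
    rw [pderiv_aeval_chain]
    simp [hJ, Finset.sum_apply]
  rw [hrow, smul_eq_mul] at hdet
  have hne : aeval f (pderiv i P) ≠ 0 := by
    intro h
    exact hP (hf.1 (by rw [h, map_zero]))
  have h1 := tdeg_det (J.updateRow i (fun j => pderiv j (aeval f P)))
    (Function.update (fun l => (f l).totalDegree) i (aeval f P).totalDegree) (by
      intro l j hl
      by_cases h : l = i
      · subst h
        rw [Matrix.updateRow_self] at hl ⊢
        rw [Function.update_self]
        exact tdeg_pderiv _ hl
      · rw [Matrix.updateRow_ne h] at hl ⊢
        rw [Function.update_of_ne h]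
        exact tdeg_pderiv _ hl) (by rw [hdet]; exact mul_ne_zero hne hJ0)
  rw [hdet, totalDegree_mul_of_isDomain hne hJ0] at h1
  rw [Finset.sum_update_of_mem (Finset.mem_univ i)] at h1
  have h2 := Finset.sum_eq_add_sum_sdiff_singleton_of_mem (Finset.mem_univ i)
    (fun l => (f l).totalDegree)
  omega

lemma tdeg_iter [Fintype σ] [DecidableEq σ] (f : σ → MvPolynomial σ K)
    (hf : Function.Bijective ⇑(aeval f : MvPolynomial σ K →ₐ[K] MvPolynomial σ K))
    (i : σ) (P : MvPolynomial σ K) (k : ℕ) (hP : (⇑(pderiv i))^[k] P ≠ 0) :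
    (aeval f ((⇑(pderiv i))^[k] P)).totalDegree + k * ((f i).totalDegree + Fintype.card σ)
      ≤ (aeval f P).totalDegree + k * ∑ l, (f l).totalDegree := by
  induction k with
  | zero => simp
  | succ k ih =>
    rw [Function.iterate_succ_apply'] at hP ⊢
    have h1 := tdeg_step f hf i _ hP
    have h2 := ih (fun h0 => hP (by rw [h0, map_zero]))
    rw [add_mul, add_mul]
    omega

end helpers

/-- Proposition: assume `I = (R)` with `R` irreducible and `∂R/∂xₙ ≠ 0`, and let `P ≠ 0`
with `P̃ ∈ (R^k) \ (R^{k+1})`.  Then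
(i) `deg₁((∂^k P/∂xₙ^k)∘Φ) = deg₂(∂^k P/∂xₙ^k) = deg₂ P - k·dₙ`;
(ii) `deg₁(P∘Φ) ≥ deg₂ P - k·∇`;
(iii) `deg₁(P∘Φ) ≥ k·(deg₂ R - ∇)`, where `∇ = d₁ + ⋯ + dₙ - n`.
Here there are `n+1` variables and `xₙ` is the last one. -/
theorem stmt16 {K : Type*} [Field K] [IsAlgClosed K] [CharZero K]
    {n : ℕ} (f : Fin (n + 1) → MvPolynomial (Fin (n + 1)) K)
    (hf : Function.Bijective
      ⇑(aeval f : MvPolynomial (Fin (n + 1)) K →ₐ[K] MvPolynomial (Fin (n + 1)) K))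
    (d : Fin (n + 1) → ℕ) (hd : ∀ i, d i = (f i).totalDegree)
    (R : MvPolynomial (Fin (n + 1)) K)
    (hI : relIdealStd f = Ideal.span {R})
    (hirr : Irreducible R) (hdR : pderiv (Fin.last n) R ≠ 0)
    (P : MvPolynomial (Fin (n + 1)) K) (hP : P ≠ 0) (k : ℕ)
    (h1 : ldt d P ∈ Ideal.span {R ^ k}) (h2 : ldt d P ∉ Ideal.span {R ^ (k + 1)}) :
    ((aeval f ((⇑(pderiv (Fin.last n)))^[k] P)).totalDegree
        = weightedTotalDegree d ((⇑(pderiv (Fin.last n)))^[k] P) ∧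
      weightedTotalDegree d ((⇑(pderiv (Fin.last n)))^[k] P) + k * d (Fin.last n)
        = weightedTotalDegree d P) ∧
    (((weightedTotalDegree d P : ℕ) : ℤ)
        - (k : ℤ) * ((∑ i, ((d i : ℕ) : ℤ)) - (n + 1))
      ≤ ((aeval f P).totalDegree : ℤ)) ∧
    ((k : ℤ) * (((weightedTotalDegree d R : ℕ) : ℤ)
        - ((∑ i, ((d i : ℕ) : ℤ)) - (n + 1)))
      ≤ ((aeval f P).totalDegree : ℤ)) := by
  have hR0 : R ≠ 0 := hirr.ne_zero
  have hRp : Prime R := hirr.prime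
  rw [Ideal.mem_span_singleton] at h1 h2
  obtain ⟨S, hS⟩ := h1
  have hRS : ¬ R ∣ S := by
    rintro ⟨T, rfl⟩
    exact h2 ⟨T, by rw [hS]; ring⟩
  have hS0 : S ≠ 0 := fun h => hRS (h ▸ dvd_zero R)
  set D := (⇑(pderiv (Fin.last n) :
    Derivation K (MvPolynomial (Fin (n + 1)) K) (MvPolynomial (Fin (n + 1)) K)))^[k] with hD
  have hnd : ¬ R ∣ D (ldt d P) := by
    rw [hS]
    exact iter_not_dvd hRp _ hdR k S hRS
  have hD0 : D (ldt d P) ≠ 0 := fun h => hnd (h ▸ dvd_zero R)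
  have hlead : HasLead d P (weightedTotalDegree d P) (ldt d P) := hasLead_of_le le_rfl
  have hbar : aeval (fun i => ltStd (f i)) (D (ldt d P)) ≠ 0 := by
    intro h
    apply hnd
    rw [← Ideal.mem_span_singleton, ← hI]
    exact h
  have hldtne : ldt d P ≠ 0 := lead_ne_zero hP
  have hldtdeg : weightedTotalDegree d (ldt d P) = weightedTotalDegree d P := by
    have hh : HasLead d (ldt d P) (weightedTotalDegree d P) (ldt d P) :=
      ⟨fun m hm => (weightedHomogeneousComponent_isWeightedHomogeneous _ _ hm).le,
        weightedHomogeneousComponent_eq_self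
          (weightedHomogeneousComponent_isWeightedHomogeneous _ _)⟩
    exact hh.eq hldtne
  have hk : k * d (Fin.last n) ≤ weightedTotalDegree d P := by
    have := wdeg_pderiv_iter (w := d) (Fin.last n) k hD0
    rw [hldtdeg] at this
    omega
  obtain ⟨a, ha⟩ := Nat.exists_eq_add_of_le' hk
  have hDl : HasLead d (D P) a (D (ldt d P)) := by
    apply HasLead.pderiv_iter
    rw [← ha]
    exact hlead
  have hdega : weightedTotalDegree d (D P) = a := hDl.eq hD0
  have hfl : ∀ i, HasLead 1 (f i) (d i) (ltStd (f i)) := by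
    intro i
    have := hasLead_of_le (w := (1 : Fin (n + 1) → ℕ)) (p := f i) (a := d i)
      (by rw [weightedTotalDegree_one, hd])
    rw [hd] at this ⊢
    exact this
  have hcomp := (HasLead.aeval hfl hDl).eq hbar
  rw [weightedTotalDegree_one] at hcomp
  have hDP0 : D P ≠ 0 := by
    intro h
    apply hD0
    rw [← hDl.2, h, map_zero]
  have hit := tdeg_iter f hf (Fin.last n) P k hDP0
  rw [← hD, hcomp, Fintype.card_fin] at hit
  simp only [← hd] at hit
  have hii : ((weightedTotalDegree d P : ℕ) : ℤ)
        - (k : ℤ) * ((∑ i, ((d i : ℕ) : ℤ)) - (n + 1))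
      ≤ ((aeval f P).totalDegree : ℤ) := by
    zify at hit ha
    linarith
  have hdR' : k * weightedTotalDegree d R ≤ weightedTotalDegree d P := by
    rw [← hldtdeg, hS, wdeg_mul (pow_ne_zero _ hR0) hS0, wdeg_pow hR0]
    exact Nat.le_add_right _ _
  refine ⟨⟨by rw [hcomp, hdega], by rw [hdega, ha]⟩, hii, ?_⟩
  zify at hdR'
  linarith
end

section
/- Let e_1 be an odd integer with e_1 ≥ 3, let a, b ∈ K*, and set R = x_3^2 + (a·x_1^{e_1} + b·x_2^2)·x_1. Then the quotient algebra K[x_1,x_2,x_3]/(R) admits no nonzero locally nilpotent K-derivation. -/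
open MvPolynomial

/-- A derivation is locally nilpotent if every element is killed by some iterate. -/
def IsLND {K A : Type*} [CommSemiring K] [CommRing A] [Algebra K A]
    (D : Derivation K A A) : Prop :=
  ∀ a : A, ∃ k : ℕ, (⇑D)^[k] a = 0

theorem lnd_common_zero {F : Type*} [Field F] [IsAlgClosed F] {d : ℕ} (hd : 0 < d)
    (P Q : MvPolynomial (Fin 2) F)
    (hP : MonomialOrder.degLex.degree P = Finsupp.single 0 d)
    (hQ : MonomialOrder.degLex.degree Q = Finsupp.single 1 d) :
    ∃ x : Fin 2 → F, eval x P = 0 ∧ eval x Q = 0 := by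
  have hP0 : P ≠ 0 := by
    rintro rfl
    have := DFunLike.congr_fun hP 0
    simp at this; omega
  have hQ0 : Q ≠ 0 := by
    rintro rfl
    have := DFunLike.congr_fun hQ 1
    simp at this; omega
  have hne : Ideal.span {P, Q} ≠ ⊤ := by
    intro h
    rw [Ideal.eq_top_iff_one, Ideal.mem_span_pair] at h
    obtain ⟨α, β, h⟩ := h
    have hQu : IsUnit (MonomialOrder.degLex.leadingCoeff Q) :=
      (MonomialOrder.leadingCoeff_ne_zero_iff.2 hQ0).isUnit
    obtain ⟨g, r, hgr, -, hr⟩ := MonomialOrder.div_single hQu α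
    have h1 : r * P + (β + g * P) * Q = 1 := by rw [← h, hgr]; ring
    set β' := β + g * P
    have key : ∀ s : MvPolynomial (Fin 2) F, s ≠ 0 →
        MonomialOrder.degLex.degree (s * Q) ≠ 0 := by
      intro s hs h0
      rw [MonomialOrder.degree_mul hs hQ0, hQ] at h0
      have := DFunLike.congr_fun h0 1
      simp at this; omega
    have hβ : β' ≠ 0 := by
      intro h0
      rw [h0, zero_mul, add_zero] at h1
      have : r ≠ 0 := by rintro rfl; simp at h1
      have h2 := MonomialOrder.degree_mul (m := MonomialOrder.degLex) this hP0
      rw [h1, hP] at h2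
      have := DFunLike.congr_fun h2 0
      simp at this; omega
    have hr0 : r ≠ 0 := by
      rintro rfl
      rw [zero_mul, zero_add] at h1
      apply key β' hβ
      rw [h1]; simp
    have hdeg : MonomialOrder.degLex.degree (r * P) = MonomialOrder.degLex.degree (β' * Q) := by
      by_contra hne
      have h3 := MonomialOrder.degree_add_of_ne hne
      have h4 : MonomialOrder.degLex.toSyn (MonomialOrder.degLex.degree (β' * Q)) ≤ 0 := by
        rw [h1] at h3
        simp at h3
        have : MonomialOrder.degLex.toSyn (MonomialOrder.degLex.degree (β' * Q)) ≤ MonomialOrder.degLex.toSyn (MonomialOrder.degLex.degree (r * P)) ⊔ MonomialOrder.degLex.toSyn (MonomialOrder.degLex.degree (β' * Q)) := le_sup_right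
        rw [← h3] at this
        exact this
      apply key β' hβ
      have h5 := le_antisymm h4 (MonomialOrder.zero_le _ _)
      simpa using h5
    rw [MonomialOrder.degree_mul hr0 hP0, MonomialOrder.degree_mul hβ hQ0, hP, hQ] at hdeg
    apply hr _ (MonomialOrder.degree_mem_support (m := MonomialOrder.degLex) hr0)
    rw [hQ]
    have := DFunLike.congr_fun hdeg 1
    simp at this
    rw [Finsupp.single_le_iff, this]; omega
  obtain ⟨I, hI, hle⟩ := Ideal.exists_le_maximal _ hne
  obtain ⟨x, hx⟩ := (isMaximal_iff_eq_vanishingIdeal_singleton (I := I)).1 hI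
  refine ⟨x, ?_, ?_⟩
  · have : P ∈ I := hle (Ideal.subset_span (by simp))
    rw [hx, mem_vanishingIdeal_singleton_iff] at this
    simpa [coe_aeval_eq_eval] using this
  · have : Q ∈ I := hle (Ideal.subset_span (by simp))
    rw [hx, mem_vanishingIdeal_singleton_iff] at this
    simpa [coe_aeval_eq_eval] using this

theorem lnd_totalDegree_le {F : Type*} [Field F] (i : Fin 2) (f : Polynomial F) (d : ℕ)
    (hf : f.natDegree < d) : (f.toMvPolynomial i).totalDegree < d := by
  rw [Polynomial.toMvPolynomial, Polynomial.aeval_eq_sum_range]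
  refine lt_of_le_of_lt ?_ hf
  refine totalDegree_finsetSum_le fun j hj => ?_
  refine (totalDegree_smul_le _ _).trans ((totalDegree_pow _ _).trans ?_)
  rw [totalDegree_X]
  simp at hj; omega

theorem lnd_degLex_degree {F : Type*} [Field F] (i j : Fin 2) (f g : Polynomial F) (d : ℕ)
    (hd : 0 < d) (hf : f.natDegree = d) (hg : g.natDegree < d) :
    MonomialOrder.degLex.degree (f.toMvPolynomial i + g.toMvPolynomial j)
      = Finsupp.single i d := by
  classical
  have hc : f.leadingCoeff ≠ 0 := by
    rw [Polynomial.leadingCoeff_ne_zero]; rintro rfl; simp at hf; omega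
  have e : f.toMvPolynomial i + g.toMvPolynomial j = monomial (Finsupp.single i d) f.leadingCoeff
      + (f.eraseLead.toMvPolynomial i + g.toMvPolynomial j) := by
    rw [← add_assoc]
    congr 1
    conv_lhs => rw [← f.eraseLead_add_C_mul_X_pow]
    rw [map_add, map_mul, map_pow, Polynomial.toMvPolynomial_C, Polynomial.toMvPolynomial_X, hf,
      add_comm, monomial_eq]
    simp
  have hdm : MonomialOrder.degLex.degree (monomial (Finsupp.single i d) f.leadingCoeff)
      = Finsupp.single i d := by
    rw [MonomialOrder.degree_monomial, if_neg hc]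
  rw [e, MonomialOrder.degree_add_of_lt, hdm]
  rw [hdm, MonomialOrder.degLex_lt_iff, Finsupp.DegLex.lt_iff]
  left
  simp only [ofDegLex_toDegLex, degree_degLexDegree, Finsupp.degree_single]
  refine lt_of_le_of_lt (totalDegree_add _ _) (max_lt ?_ ?_)
  · apply lnd_totalDegree_le
    have := f.eraseLead_natDegree_le
    omega
  · exact lnd_totalDegree_le _ _ _ hg

theorem lnd_common_zero' {F : Type*} [Field F] [IsAlgClosed F] {d : ℕ} (hd : 0 < d)
    (A B C E : Polynomial F) (hA : A.natDegree = d) (hB : B.natDegree < d)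
    (hC : C.natDegree < d) (hE : E.natDegree = d) :
    ∃ s t : F, A.eval s = B.eval t ∧ C.eval s = E.eval t := by
  obtain ⟨x, h1, h2⟩ := lnd_common_zero hd (A.toMvPolynomial 0 + (-B).toMvPolynomial 1)
    (E.toMvPolynomial 1 + (-C).toMvPolynomial 0)
    (lnd_degLex_degree _ _ _ _ _ hd hA (by simpa using hB))
    (lnd_degLex_degree _ _ _ _ _ hd hE (by simpa using hC))
  have ev : ∀ (p : Polynomial F) (i : Fin 2), eval x (p.toMvPolynomial i) = p.eval (x i) := by
    intro p i
    induction p using Polynomial.induction_on' with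
    | add p q hp hq => simp [hp, hq]
    | monomial n a => simp [← Polynomial.C_mul_X_pow_eq_monomial]
  refine ⟨x 0, x 1, ?_, ?_⟩
  · simpa [ev, ← sub_eq_add_neg, sub_eq_zero] using h1
  · have : E.eval (x 1) = C.eval (x 0) := by simpa [ev, ← sub_eq_add_neg, sub_eq_zero] using h2
    exact this.symm

theorem lnd_twist_zero {F : Type*} [Field F] [IsAlgClosed F] {d : ℕ} (hd : 0 < d)
    (m n : Polynomial F) (hm : m.natDegree ≤ d) (hn : n.natDegree ≤ d) (κ κ' : F)
    (hdet : κ * n.coeff d ^ 2 - κ' * m.coeff d ^ 2 ≠ 0) :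
    ∃ s t : F, m.eval s = κ * n.eval t ∧ n.eval s = κ' * m.eval t := by
  set m0 := m.coeff d
  set n0 := n.coeff d
  have aux : ∀ u v : F, (Polynomial.C u * m + Polynomial.C v * n).natDegree ≤ d := by
    intro u v
    refine (Polynomial.natDegree_add_le _ _).trans (max_le ?_ ?_)
    · exact (Polynomial.natDegree_C_mul_le _ _).trans hm
    · exact (Polynomial.natDegree_C_mul_le _ _).trans hn
  have lt : ∀ u v : F, u * m0 + v * n0 = 0 →
      (Polynomial.C u * m + Polynomial.C v * n).natDegree < d := by
    intro u v h
    refine lt_of_le_of_ne (aux u v) fun h' => ?_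
    have h2 : (Polynomial.C u * m + Polynomial.C v * n).leadingCoeff = 0 := by
      rw [Polynomial.leadingCoeff, h']; simpa using h
    rw [Polynomial.leadingCoeff_eq_zero] at h2
    rw [h2] at h'
    simp at h'; omega
  have eq : ∀ u v : F, u * m0 + v * n0 ≠ 0 →
      (Polynomial.C u * m + Polynomial.C v * n).natDegree = d := by
    intro u v h
    refine le_antisymm (aux u v) (Polynomial.le_natDegree_of_ne_zero ?_)
    simpa using h
  obtain ⟨s, t, h1, h2⟩ := lnd_common_zero' hd
    (Polynomial.C (-κ' * m0) * m + Polynomial.C (κ * n0) * n)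
    (Polynomial.C (κ * n0 * κ') * m + Polynomial.C (-κ' * m0 * κ) * n)
    (Polynomial.C (n0) * m + Polynomial.C (-m0) * n)
    (Polynomial.C (-m0 * κ') * m + Polynomial.C (n0 * κ) * n)
    (eq _ _ (by convert hdet using 1; ring)) (lt _ _ (by ring)) (lt _ _ (by ring))
    (eq _ _ (by convert hdet using 1; ring))
  simp only [Polynomial.eval_add, Polynomial.eval_mul, Polynomial.eval_C] at h1 h2
  refine ⟨s, t, ?_, ?_⟩
  · apply mul_left_cancel₀ hdet
    linear_combination m0 * h1 + κ * n0 * h2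
  · apply mul_left_cancel₀ hdet
    linear_combination n0 * h1 + κ' * m0 * h2

namespace Polynomial

theorem lnd_root {F : Type*} [Field F] [IsAlgClosed F] {k : ℕ} (hk : 0 < k)
    {d p : Polynomial F} (h : Associated (d ^ k) p) : ∃ s, p = s ^ k := by
  obtain ⟨u, rfl⟩ := h
  obtain ⟨c, hc, hu⟩ := Polynomial.isUnit_iff.1 u.isUnit
  obtain ⟨z, hz⟩ := IsAlgClosed.exists_pow_nat_eq c hk
  exact ⟨d * Polynomial.C z, by rw [mul_pow, ← Polynomial.C_pow, hz, hu]⟩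

theorem lnd_param {F : Type*} [Field F] [IsAlgClosed F] [CharZero F] (e : ℕ) (he : 0 < e)
    (a b : F) (ha : a ≠ 0) (hb : b ≠ 0) (X Y Z : F[X]) (hX : X ≠ 0)
    (hrel : Z ^ 2 + (C a * X ^ e + C b * Y ^ 2) * X = 0)
    (hnz : ∀ t, ¬ (X.eval t = 0 ∧ Y.eval t = 0 ∧ Z.eval t = 0)) :
    ∃ (m n : F[X]) (p q r : F), X = C p * (m * n) ^ 2 ∧
      Y = C q * (n ^ (2 * e) - m ^ (2 * e)) ∧
      Z = C r * (m * n) * (n ^ (2 * e) + m ^ (2 * e)) := by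
  obtain ⟨ι, hι⟩ := IsAlgClosed.exists_pow_nat_eq (-1 : F) (n := 2) (by norm_num)
  obtain ⟨β, hβ⟩ := IsAlgClosed.exists_pow_nat_eq b (n := 2) (by norm_num)
  obtain ⟨α, hα⟩ := IsAlgClosed.exists_pow_nat_eq a (n := 2 * e) (by omega)
  have hβ0 : β ≠ 0 := by rintro rfl; simp at hβ; exact hb hβ.symm
  have hα0 : α ≠ 0 := by rintro rfl; rw [zero_pow (by omega)] at hα; exact ha hα.symm
  have hCι : (C ι : F[X]) ^ 2 = -1 := by rw [← C_pow, hι]; simp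
  have hCβ : (C β : F[X]) ^ 2 = C b := by rw [← C_pow, hβ]
  have hCα : (C α : F[X]) ^ (2 * e) = C a := by rw [← C_pow, hα]
  set W := C a * X ^ e + C b * Y ^ 2 with hW
  have hZ0 : ∀ t, X.eval t = 0 → Z.eval t = 0 := by
    intro t ht
    have := congrArg (Polynomial.eval t) hrel
    simpa [ht] using this
  have hco : IsCoprime X W := by
    rw [Polynomial.isCoprime_iff_aeval_ne_zero_of_isAlgClosed F F]
    intro t
    by_contra! hcon
    obtain ⟨h1, h2⟩ := hcon
    simp only [coe_aeval_eq_eval] at h1 h2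
    have hY : Y.eval t = 0 := by
      simp [hW, h1, he.ne', hb] at h2
      exact h2
    exact hnz t ⟨h1, hY, hZ0 t h1⟩
  have hprod : X * W = (C ι * Z) ^ 2 := by
    rw [mul_pow, hCι]; linear_combination hrel
  obtain ⟨d, hd⟩ := exists_associated_pow_of_mul_eq_pow' hco hprod
  obtain ⟨s, hs⟩ := lnd_root (by norm_num) hd
  have hs0 : s ≠ 0 := by rintro rfl; simp at hs; exact hX hs
  have hsZ : s ∣ Z := by
    rw [← IsIntegrallyClosed.pow_dvd_pow_iff (n := 2) two_ne_zero]
    exact ⟨-W, by rw [← hs]; linear_combination hrel⟩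
  obtain ⟨w', hw'⟩ := hsZ
  have hWw : W = (C ι * w') ^ 2 := by
    apply mul_left_cancel₀ (pow_ne_zero 2 hs0)
    rw [mul_pow, hCι, ← hs]
    rw [hw'] at hrel
    rw [hs] at hrel ⊢
    linear_combination hrel
  set w := C ι * w' with hw
  have hZw : Z = - C ι * s * w := by
    rw [hw, hw']; linear_combination (s * w') * hCι
  have hco2 : IsCoprime (w - C β * Y) (w + C β * Y) := by
    rw [Polynomial.isCoprime_iff_aeval_ne_zero_of_isAlgClosed F F]
    intro t
    by_contra! hcon
    obtain ⟨h1, h2⟩ := hcon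
    simp only [coe_aeval_eq_eval, eval_add, eval_sub, eval_mul, eval_C] at h1 h2
    have h3 : w.eval t = 0 := by linear_combination (h1 + h2) / 2
    have h4 : Y.eval t = 0 := by
      have : β * Y.eval t = 0 := by linear_combination (h2 - h1) / 2
      simpa [hβ0] using this
    have h5 : X.eval t = 0 := by
      have := congrArg (Polynomial.eval t) hWw
      rw [hW] at this
      simp [h3, h4, ha, he.ne'] at this
      exact this
    exact hnz t ⟨h5, h4, hZ0 t h5⟩
  have hprod2 : (w - C β * Y) * (w + C β * Y) = (C α * s) ^ (2 * e) := by
    rw [mul_pow, hCα, pow_mul s, ← hs]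
    linear_combination (-Y ^ 2) * hCβ - hWw
  obtain ⟨d2, hd2⟩ := exists_associated_pow_of_mul_eq_pow' hco2 hprod2
  obtain ⟨m, hm⟩ := lnd_root (by omega) hd2
  have hαs : C α * s ≠ 0 := mul_ne_zero (by simpa using hα0) hs0
  have hdv : m ∣ C α * s := by
    rw [← IsIntegrallyClosed.pow_dvd_pow_iff (n := 2 * e) (by omega)]
    exact ⟨w + C β * Y, by rw [← hm, hprod2]⟩
  obtain ⟨n, hn⟩ := hdv
  have hm0 : m ≠ 0 := by rintro rfl; simp at hn; simp_all
  have hn2 : w + C β * Y = n ^ (2 * e) := by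
    apply mul_left_cancel₀ (pow_ne_zero (2 * e) hm0)
    rw [← mul_pow, ← hn, ← hprod2, hm]
  have hs' : s = C α⁻¹ * (m * n) := by
    rw [← hn, ← mul_assoc, ← C_mul, inv_mul_cancel₀ hα0]; simp
  have h2 : (C (2⁻¹ : F) : F[X]) * 2 = 1 := by
    have : (2 : F[X]) = C 2 := (map_ofNat C 2).symm
    rw [this, ← C_mul]; simp
  have hβi : (C (β⁻¹ : F) : F[X]) * C β = 1 := by
    rw [← C_mul, inv_mul_cancel₀ hβ0]; simp
  refine ⟨m, n, (α⁻¹) ^ 2, 2⁻¹ * β⁻¹, - ι * α⁻¹ * 2⁻¹, ?_, ?_, ?_⟩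
  · rw [hs, hs', C_pow]; ring
  · rw [← hn2, ← hm, C_mul]
    linear_combination (-Y) * h2 - (C 2⁻¹ * 2 * Y) * hβi
  · rw [← hn2, ← hm, hZw, hs']
    simp only [C_mul, C_neg]
    linear_combination (C ι * C α⁻¹ * m * n * w) * h2

theorem lnd_core {F : Type*} [Field F] [IsAlgClosed F] [CharZero F] (e : ℕ) (hodd : Odd e)
    (he : 3 ≤ e) (a b : F) (ha : a ≠ 0) (hb : b ≠ 0) (X Y Z : F[X]) (hX : X ≠ 0)
    (hrel : Z ^ 2 + (C a * X ^ e + C b * Y ^ 2) * X = 0)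
    (hnz : ∀ t, ¬ (X.eval t = 0 ∧ Y.eval t = 0 ∧ Z.eval t = 0))
    (hinj : ∀ s t, X.eval s = X.eval t → Y.eval s = Y.eval t → Z.eval s = Z.eval t → s = t) :
    False := by
  obtain ⟨m, n, p, q, r, h1, h2, h3⟩ :=
    lnd_param e (by omega) a b ha hb X Y Z hX hrel hnz
  set d := max m.natDegree n.natDegree with hd
  have hd0 : 0 < d := by
    rw [Nat.pos_iff_ne_zero]
    intro h0
    have hm : m.natDegree = 0 := by omega
    have hn : n.natDegree = 0 := by omega
    rw [eq_C_of_natDegree_eq_zero hm, eq_C_of_natDegree_eq_zero hn] at h1 h2 h3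
    have := hinj 0 1 (by simp [h1]) (by simp [h2]) (by simp [h3])
    exact zero_ne_one this
  have hco : ¬ (m.coeff d = 0 ∧ n.coeff d = 0) := by
    rintro ⟨hm, hn⟩
    rcases max_choice m.natDegree n.natDegree with h | h
    · rw [hd, h, coeff_natDegree, leadingCoeff_eq_zero] at hm
      simp [hm] at h
      simp [hm, h] at hd; omega
    · rw [hd, h, coeff_natDegree, leadingCoeff_eq_zero] at hn
      simp [hn] at h
      simp [hn, h] at hd; omega
  obtain ⟨κ, hκ, hκd⟩ : ∃ κ : F, κ ^ (2 * e) = -1 ∧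
      κ ^ 2 * n.coeff d ^ 2 + m.coeff d ^ 2 ≠ 0 := by
    by_cases hc : -n.coeff d ^ 2 + m.coeff d ^ 2 = 0
    · have : NeZero (e : F) := ⟨by simp; omega⟩
      obtain ⟨ω, hω⟩ := HasEnoughRootsOfUnity.exists_primitiveRoot F e
      obtain ⟨κ, hκ⟩ := IsAlgClosed.exists_pow_nat_eq (-ω : F) (n := 2) (by norm_num)
      refine ⟨κ, ?_, ?_⟩
      · rw [pow_mul, hκ, hodd.neg_pow, hω.pow_eq_one]
      · rw [hκ]
        have : -ω * n.coeff d ^ 2 + m.coeff d ^ 2 = (1 - ω) * n.coeff d ^ 2 := by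
          linear_combination hc
        rw [this]
        refine mul_ne_zero (sub_ne_zero.2 (hω.ne_one (by omega)).symm) (pow_ne_zero 2 ?_)
        intro hn0
        apply hco
        refine ⟨?_, hn0⟩
        simpa [hn0] using hc
    · obtain ⟨κ, hκ⟩ := IsAlgClosed.exists_pow_nat_eq (-1 : F) (n := 2) (by norm_num)
      refine ⟨κ, ?_, ?_⟩
      · rw [pow_mul, hκ, hodd.neg_pow, one_pow]
      · rw [hκ]; simpa using hc
  have hκ0 : κ ≠ 0 := by rintro rfl; rw [zero_pow (by omega)] at hκ; simp at hκ
  obtain ⟨s, t, hst1, hst2⟩ := lnd_twist_zero hd0 m n (le_max_left _ _) (le_max_right _ _)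
    κ (-κ⁻¹) (by
      intro h
      apply hκd
      have := congrArg (κ * ·) h
      simp only [mul_zero] at this
      rw [← this]
      field_simp
      ring)
  have e1 : m.eval s ^ (2 * e) = - n.eval t ^ (2 * e) := by
    rw [hst1, mul_pow, hκ]; ring
  have e2 : n.eval s ^ (2 * e) = - m.eval t ^ (2 * e) := by
    rw [hst2, mul_pow, Even.neg_pow (even_two_mul e), inv_pow, hκ]; ring
  have e3 : m.eval s * n.eval s = - (m.eval t * n.eval t) := by
    rw [hst1, hst2]; field_simp
  have hs : s = t := by
    apply hinj
    · simp only [h1, eval_mul, eval_pow, eval_C]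
      rw [e3]; ring
    · simp only [h2, eval_mul, eval_pow, eval_C, eval_sub]
      rw [e1, e2]; ring
    · simp only [h3, eval_mul, eval_pow, eval_C, eval_add]
      rw [e3, e1, e2]; ring
  subst hs
  have z1 : m.eval s = 0 := by
    have : m.eval s = - m.eval s := by
      conv_lhs => rw [hst1, hst2]
      field_simp
    exact self_eq_neg.1 this
  have z2 : n.eval s = 0 := by rw [hst2, z1, mul_zero]
  apply hnz s
  refine ⟨by simp [h1, z1], ?_, by simp [h3, z1]⟩
  have : 2 * e ≠ 0 := by omega
  simp [h2, z1, z2, this]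

end Polynomial

theorem lnd_exp {K A F : Type*} [Field K] [CommRing A] [Algebra K A] [Field F] [CharZero F]
    (i : A →+* F) (D : Derivation K A A) (hD : IsLND D) :
    ∃ E : A →+* Polynomial F, ∀ a n, (E a).coeff n = i ((⇑D)^[n] a) / (n.factorial : F) := by
  let g : A → PowerSeries F := fun a =>
    PowerSeries.mk fun n => i ((⇑D)^[n] a) / (n.factorial : F)
  have itadd : ∀ n a b, (⇑D)^[n] (a + b) = (⇑D)^[n] a + (⇑D)^[n] b := by
    intro n
    induction n with
    | zero => intro a b; rfl
    | succ n ih => intro a b; simp only [Function.iterate_succ_apply, map_add, ih]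
  have gadd : ∀ a b, g (a + b) = g a + g b := by
    intro a b
    ext n
    simp only [g, PowerSeries.coeff_mk, map_add, itadd]
    ring
  have gder : ∀ a, PowerSeries.derivative F (g a) = g (D a) := by
    intro a
    ext n
    rw [PowerSeries.coeff_derivative]
    simp only [g, PowerSeries.coeff_mk, Function.iterate_succ_apply, Nat.factorial_succ]
    have h1 : (n.factorial : F) ≠ 0 := by exact_mod_cast n.factorial_ne_zero
    have h2 : ((n : F) + 1) ≠ 0 := by exact_mod_cast n.succ_ne_zero
    push_cast
    field_simp
  have gmul : ∀ n a b, PowerSeries.coeff n (g (a * b)) = PowerSeries.coeff n (g a * g b) := by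
    intro n
    induction n with
    | zero => intro a b; simp [g]
    | succ n ih =>
      intro a b
      have h2 : ((n : F) + 1) ≠ 0 := by exact_mod_cast n.succ_ne_zero
      apply mul_right_cancel₀ h2
      rw [← PowerSeries.coeff_derivative, ← PowerSeries.coeff_derivative, gder,
        Derivation.leibniz, Derivation.leibniz, gadd, map_add, map_add, gder, gder]
      simp only [smul_eq_mul, ih]
  have gone : g 1 = 1 := by
    ext n
    cases n with
    | zero => simp [g]
    | succ n =>
      have : ∀ n, (⇑D)^[n] 0 = 0 := fun n => by
        induction n with
        | zero => rfl
        | succ n ih => simp [ih]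
      simp [g, PowerSeries.coeff_one, this]
  have gzero : g 0 = 0 := by
    have := gadd 0 0
    simpa using this
  have hpoly : ∀ a, ∃ p : Polynomial F, (p : PowerSeries F) = g a := by
    intro a
    obtain ⟨k, hk⟩ := hD a
    refine ⟨PowerSeries.trunc k (g a), ?_⟩
    ext n
    rw [Polynomial.coeff_coe, PowerSeries.coeff_trunc]
    split_ifs with h
    · rfl
    · have : ∀ n, (⇑D)^[n] 0 = 0 := fun n => by
        induction n with
        | zero => rfl
        | succ n ih => simp [ih]
      have h3 : (⇑D)^[n] a = 0 := by
        rw [show n = (n - k) + k by omega, Function.iterate_add_apply, hk, this]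
      simp [g, h3]
  choose f hf using hpoly
  refine ⟨{ toFun := f, map_one' := ?_, map_mul' := ?_, map_zero' := ?_, map_add' := ?_ }, ?_⟩
  · apply Polynomial.coe_injective; simp [hf, gone]
  · intro a b; apply Polynomial.coe_injective
    simp only [Polynomial.coe_mul, hf]
    ext n; exact gmul n a b
  · apply Polynomial.coe_injective; simp [hf, gzero]
  · intro a b; apply Polynomial.coe_injective; simp [hf, gadd]
  · intro a n
    change (f a).coeff n = _
    rw [← Polynomial.coeff_coe, hf]
    simp [g]

theorem lnd_irred {K : Type*} [Field K] (e : ℕ) (he : 1 ≤ e) (a b : K) (hb : b ≠ 0) :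
    Prime (X 2 ^ 2 + (C a * X 0 ^ e + C b * X 1 ^ 2) * X 0 : MvPolynomial (Fin 3) K) := by
  rw [← irreducible_iff_prime]
  let φ := (renameEquiv K (Equiv.swap (0 : Fin 3) 2)).trans (finSuccEquiv K 2)
  rw [← MulEquiv.irreducible_iff φ]
  set c : MvPolynomial (Fin 2) K := (C a * X 1 ^ e + C b * X 0 ^ 2) * X 1 with hc
  have h0 : φ (X 0) = Polynomial.C (X 1) := by
    simp only [φ, AlgEquiv.trans_apply, renameEquiv_apply, rename_X, Equiv.swap_apply_left]
    exact finSuccEquiv_X_succ (j := 1)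
  have h1 : φ (X 1) = Polynomial.C (X 0) := by
    simp only [φ, AlgEquiv.trans_apply, renameEquiv_apply, rename_X]
    rw [Equiv.swap_apply_of_ne_of_ne (by decide) (by decide)]
    exact finSuccEquiv_X_succ (j := 0)
  have h2 : φ (X 2) = Polynomial.X := by
    simp only [φ, AlgEquiv.trans_apply, renameEquiv_apply, rename_X, Equiv.swap_apply_right]
    exact finSuccEquiv_X_zero
  have h3 : ∀ k : K, φ (C k) = Polynomial.C (C k) := by
    intro k
    exact φ.commutes k
  have him : φ (X 2 ^ 2 + (C a * X 0 ^ e + C b * X 1 ^ 2) * X 0) = Polynomial.X ^ 2 + Polynomial.C c := by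
    simp only [map_add, map_mul, map_pow, h0, h1, h2, h3, hc]
  rw [him]
  have hmon : (Polynomial.X ^ 2 + Polynomial.C c).Monic := Polynomial.monic_X_pow_add_C c two_ne_zero
  have hdeg : (Polynomial.X ^ 2 + Polynomial.C c).degree = 2 :=
    Polynomial.degree_X_pow_add_C (by norm_num) c
  have hpr : (Ideal.span {(X 1 : MvPolynomial (Fin 2) K)}).IsPrime := by
    rw [Ideal.span_singleton_prime (X_ne_zero _)]
    exact X_prime
  apply Polynomial.irreducible_of_eisenstein_criterion hpr
  · rw [hmon.leadingCoeff]
    exact fun h => hpr.ne_top ((Ideal.eq_top_iff_one _).2 h)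
  · intro n hn
    rw [hdeg] at hn
    have hn : n < 2 := by exact_mod_cast hn
    have hcm : c ∈ Ideal.span {(X 1 : MvPolynomial (Fin 2) K)} :=
      Ideal.mem_span_singleton.2 (Dvd.intro_left _ rfl)
    interval_cases n
    · simpa using hcm
    · simp [Polynomial.coeff_X_pow, Polynomial.coeff_C]
  · rw [hdeg]; norm_num
  · simp only [Polynomial.coeff_add, Polynomial.coeff_X_pow, Polynomial.coeff_C_zero]
    rw [Ideal.span_singleton_pow, Ideal.mem_span_singleton]
    norm_num
    rw [hc, pow_two]
    intro hdv
    have := (mul_dvd_mul_iff_right (X_ne_zero (R := K) (1 : Fin 2))).1 hdv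
    obtain ⟨q, hq⟩ := this
    have := congrArg (eval ![1, 0]) hq
    simp [show e ≠ 0 by omega] at this
    exact hb this
  · exact hmon.isPrimitive

theorem lnd_coeff_zero {K : Type*} [Field K] {m s : Fin 3 →₀ ℕ} (i : Fin 3) (h : m i < s i)
    (c : K) (p : MvPolynomial (Fin 3) K) : coeff m (monomial s c * p) = 0 := by
  rw [coeff_monomial_mul', if_neg]
  intro hle
  exact absurd (hle i) (by omega)

theorem lnd_sing {K : Type*} [Field K] [CharZero K] (e : ℕ) (he : 2 ≤ e) (a b : K) (hb : b ≠ 0)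
    (p q r s : MvPolynomial (Fin 3) K)
    (h : 2 * X 2 * r + (C a * ((e + 1 : ℕ) : MvPolynomial (Fin 3) K) * X 0 ^ e + C b * X 1 ^ 2) * p + 2 * C b * X 0 * X 1 * q
      = (X 2 ^ 2 + (C a * X 0 ^ e + C b * X 1 ^ 2) * X 0) * s) :
    constantCoeff p = 0 ∧ constantCoeff q = 0 ∧ constantCoeff r = 0 := by
  have h' : monomial (Finsupp.single 2 1) 2 * r + monomial (Finsupp.single 0 e) (a * (e + 1 : ℕ)) * p
      + monomial (Finsupp.single 1 2) b * p
      + monomial (Finsupp.single 0 1 + Finsupp.single 1 1) (2 * b) * q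
      = monomial (Finsupp.single 2 2) 1 * s + monomial (Finsupp.single 0 (e + 1)) a * s
      + monomial (Finsupp.single 1 2 + Finsupp.single 0 1) b * s := by
    have hC2 : (C 2 : MvPolynomial (Fin 3) K) = 2 := map_ofNat C 2
    have e1 : (monomial (Finsupp.single 2 1) 2 : MvPolynomial (Fin 3) K) = 2 * X 2 := by
      rw [← C_mul_X_eq_monomial, hC2]
    have e2 : (monomial (Finsupp.single 0 e) (a * (e + 1 : ℕ)) : MvPolynomial (Fin 3) K)
        = C a * ((e + 1 : ℕ) : MvPolynomial (Fin 3) K) * X 0 ^ e := by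
      rw [← C_mul_X_pow_eq_monomial]; simp
    have e3 : (monomial (Finsupp.single 1 2) b : MvPolynomial (Fin 3) K) = C b * X 1 ^ 2 := by
      rw [← C_mul_X_pow_eq_monomial]
    have e4 : (monomial (Finsupp.single 0 1 + Finsupp.single 1 1) (2 * b) :
        MvPolynomial (Fin 3) K) = 2 * C b * X 0 * X 1 := by
      rw [← mul_one (2 * b), ← monomial_mul, ← C_mul_X_eq_monomial]; simp [X, hC2]
    have e5 : (monomial (Finsupp.single 2 2) 1 : MvPolynomial (Fin 3) K) = X 2 ^ 2 := by
      rw [← C_mul_X_pow_eq_monomial]; simp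
    have e6 : (monomial (Finsupp.single 0 (e + 1)) a : MvPolynomial (Fin 3) K)
        = C a * X 0 ^ (e + 1) := by
      rw [← C_mul_X_pow_eq_monomial]
    have e7 : (monomial (Finsupp.single 1 2 + Finsupp.single 0 1) b :
        MvPolynomial (Fin 3) K) = C b * X 1 ^ 2 * X 0 := by
      rw [← mul_one b, ← monomial_mul, ← C_mul_X_pow_eq_monomial]; simp [X]
    rw [e1, e2, e3, e4, e5, e6, e7]
    linear_combination h
  have key : ∀ (m : Fin 3 →₀ ℕ) (c : K) (f : MvPolynomial (Fin 3) K),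
      coeff m (monomial m c * f) = c * constantCoeff f := by
    intro m c f
    rw [coeff_monomial_mul', if_pos le_rfl]; simp [constantCoeff_eq]
  refine ⟨?_, ?_, ?_⟩
  · have := congrArg (coeff (Finsupp.single 1 2)) h'
    simp only [coeff_add] at this
    rw [key, lnd_coeff_zero 2 (by simp), lnd_coeff_zero 0 (by simp; omega),
      lnd_coeff_zero 0 (by simp), lnd_coeff_zero 2 (by simp), lnd_coeff_zero 0 (by simp),
      lnd_coeff_zero 0 (by simp)] at this
    simpa [hb] using this
  · have := congrArg (coeff (Finsupp.single 0 1 + Finsupp.single 1 1)) h'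
    simp only [coeff_add] at this
    rw [key, lnd_coeff_zero 2 (by simp), lnd_coeff_zero 0 (by simp; omega),
      lnd_coeff_zero 1 (by simp), lnd_coeff_zero 2 (by simp), lnd_coeff_zero 0 (by simp; omega),
      lnd_coeff_zero 1 (by simp)] at this
    simpa [hb] using this
  · have := congrArg (coeff (Finsupp.single 2 1)) h'
    simp only [coeff_add] at this
    rw [key, lnd_coeff_zero 0 (by simp; omega), lnd_coeff_zero 1 (by simp),
      lnd_coeff_zero 1 (by simp), lnd_coeff_zero 2 (by simp), lnd_coeff_zero 0 (by simp),
      lnd_coeff_zero 1 (by simp)] at this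
    simpa using this

theorem lnd_abs {K A : Type*} [Field K] [IsAlgClosed K] [CharZero K] [CommRing A] [IsDomain A]
    [Algebra K A] (e : ℕ) (hodd : Odd e) (he : 3 ≤ e) (a b : K) (ha : a ≠ 0) (hb : b ≠ 0)
    (π : MvPolynomial (Fin 3) K →ₐ[K] A) (hsurj : Function.Surjective π)
    (hker : ∀ f, π f = 0 ↔ (X 2 ^ 2 + (C a * X 0 ^ e + C b * X 1 ^ 2) * X 0) ∣ f)
    (D : Derivation K A A) (hD : IsLND D) : D = 0 := by
  by_contra hne
  have hrelA : π (X 2) ^ 2 + (algebraMap K A a * π (X 0) ^ e + algebraMap K A b * π (X 1) ^ 2)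
      * π (X 0) = 0 := by
    have := (hker _).2 dvd_rfl
    simpa [algHom_C] using this
  -- constant coefficients
  have hcc : ∀ f, π f = 0 → constantCoeff f = 0 := by
    intro f hf
    obtain ⟨q, rfl⟩ := (hker f).1 hf
    simp
  obtain ⟨p, hp⟩ := hsurj (D (π (X 0)))
  obtain ⟨q, hq⟩ := hsurj (D (π (X 1)))
  obtain ⟨r, hr⟩ := hsurj (D (π (X 2)))
  have hsing : constantCoeff p = 0 ∧ constantCoeff q = 0 ∧ constantCoeff r = 0 := by
    have h0 := congrArg D hrelA
    simp only [map_add, Derivation.leibniz, Derivation.leibniz_pow, Derivation.map_algebraMap,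
      map_zero, smul_eq_mul, nsmul_eq_mul, ← hp, ← hq, ← hr, smul_zero, mul_zero, add_zero] at h0
    have h1 : π (2 * X 2 * r + (C a * ((e + 1 : ℕ) : MvPolynomial (Fin 3) K) * X 0 ^ e
        + C b * X 1 ^ 2) * p + 2 * C b * X 0 * X 1 * q) = 0 := by
      simp only [map_add, map_mul, map_pow, map_natCast, map_ofNat, algHom_C]
      obtain ⟨k, rfl⟩ : ∃ k, e = k + 1 := ⟨e - 1, by omega⟩
      simp only [Nat.add_sub_cancel] at h0
      push_cast at h0 ⊢
      linear_combination h0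
    obtain ⟨s, hs⟩ := (hker _).1 h1
    exact lnd_sing e (by omega) a b hb p q r s hs
  have hDcc : ∀ f g, π g = D (π f) → constantCoeff g = 0 := by
    intro f
    induction f using MvPolynomial.induction_on with
    | C k =>
      intro g hg
      apply hcc
      rw [hg, algHom_C, Derivation.map_algebraMap]
    | add f₁ f₂ h₁ h₂ =>
      intro g hg
      obtain ⟨g₁, hg₁⟩ := hsurj (D (π f₁))
      obtain ⟨g₂, hg₂⟩ := hsurj (D (π f₂))
      have := hcc (g - (g₁ + g₂)) (by simp [hg, hg₁, hg₂])
      rw [map_sub, map_add, h₁ _ hg₁, h₂ _ hg₂] at this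
      simpa using this
    | mul_X f₁ i h₁ =>
      intro g hg
      obtain ⟨g₁, hg₁⟩ := hsurj (D (π f₁))
      have hi : ∃ u, π u = D (π (X i)) ∧ constantCoeff u = 0 := by
        fin_cases i
        · exact ⟨p, hp, hsing.1⟩
        · exact ⟨q, hq, hsing.2.1⟩
        · exact ⟨r, hr, hsing.2.2⟩
      obtain ⟨u, hu, hu0⟩ := hi
      have := hcc (g - (f₁ * u + X i * g₁)) (by simp [hg, hg₁, hu, Derivation.leibniz])
      rw [map_sub, map_add, map_mul, map_mul, h₁ _ hg₁, hu0] at this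
      simpa using this
  -- local slice
  obtain ⟨w, hw1, hw2⟩ : ∃ w, D w ≠ 0 ∧ D (D w) = 0 := by
    by_contra hno
    push Not at hno
    apply hne
    have hpull : ∀ w, D (D w) = 0 → D w = 0 := fun w h => by
      by_contra h'
      exact hno w h' h
    have : ∀ k w, (⇑D)^[k] (D w) = 0 → D w = 0 := by
      intro k
      induction k with
      | zero => intro w h; exact h
      | succ k ih =>
        intro w h
        rw [Function.iterate_succ_apply] at h
        exact hpull w (ih _ h)
    ext w
    obtain ⟨k, hk⟩ := hD (D w)
    exact this k w hk
  let F := AlgebraicClosure (FractionRing A)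
  let i : A →+* F := (algebraMap (FractionRing A) F).comp (algebraMap A (FractionRing A))
  have hi : Function.Injective i :=
    (algebraMap (FractionRing A) F).injective.comp (IsFractionRing.injective A (FractionRing A))
  haveI : CharZero F := charZero_of_injective_ringHom (f := i.comp (algebraMap K A))
    (hi.comp (algebraMap K A).injective)
  obtain ⟨E, hE⟩ := lnd_exp i D hD
  have hz : ∀ n, (⇑D)^[n] 0 = 0 := fun n => by
    induction n with
    | zero => rfl
    | succ n ih => rw [Function.iterate_succ_apply, map_zero, ih]
  have hEc : ∀ c, D c = 0 → E c = Polynomial.C (i c) := by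
    intro c hc
    ext n
    rw [hE, Polynomial.coeff_C]
    cases n with
    | zero => simp
    | succ n => simp [hc, hz]
  have hEw : E w = Polynomial.C (i w) + Polynomial.C (i (D w)) * Polynomial.X := by
    ext n
    rw [hE]
    match n with
    | 0 => simp
    | 1 => simp
    | n + 2 => simp [hw2, hz, Polynomial.coeff_X, Polynomial.coeff_C]
  have hEk : ∀ k, E (algebraMap K A k) = Polynomial.C (i (algebraMap K A k)) :=
    fun k => hEc _ (D.map_algebraMap k)
  have hi0 : ∀ u, i u = 0 → u = 0 := fun u hu => hi (by rw [hu, map_zero])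
  refine Polynomial.lnd_core e hodd he (i (algebraMap K A a)) (i (algebraMap K A b)) ?_ ?_
    (E (π (X 0))) (E (π (X 1))) (E (π (X 2))) ?_ ?_ ?_ ?_
  · intro h
    exact ha ((algebraMap K A).injective (by rw [hi0 _ h, map_zero]))
  · intro h
    exact hb ((algebraMap K A).injective (by rw [hi0 _ h, map_zero]))
  · intro h
    have h1 := hE (π (X 0)) 0
    rw [h] at h1
    have h2 : π (X 0) = 0 := by
      apply hi0
      simpa using h1.symm
    obtain ⟨u, hu⟩ := (hker _).1 h2
    obtain ⟨v, hv⟩ := IsAlgClosed.exists_pow_nat_eq (-a) (n := 2) (by norm_num)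
    have := congrArg (eval ![1, 0, v]) hu
    simp [hv] at this
  · have := congrArg E hrelA
    simpa only [map_add, map_mul, map_pow, hEk, map_zero] using this
  · rintro t ⟨h0, h1, h2⟩
    obtain ⟨g, hg⟩ := hsurj (D w)
    obtain ⟨w', rfl⟩ := hsurj w
    have hg0 := hDcc w' g hg
    let φ : MvPolynomial (Fin 3) K →+* F := (Polynomial.evalRingHom t).comp (E.comp (π : _ →+* A))
    have hφ : φ = (φ.comp C).comp constantCoeff := by
      apply MvPolynomial.ringHom_ext
      · intro k; simp
      · intro j
        fin_cases j
        · simpa [φ] using h0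
        · simpa [φ] using h1
        · simpa [φ] using h2
    have h3 : φ g = 0 := by
      rw [hφ]; simp [hg0]
    have h4 : φ g = i (D (π w')) := by
      change Polynomial.eval t (E (π g)) = _
      rw [hg, hEc _ hw2, Polynomial.eval_C]
    exact hw1 (hi0 _ (h4.symm.trans h3))
  · intro s t h0 h1 h2
    obtain ⟨w', rfl⟩ := hsurj w
    have hφ : (Polynomial.evalRingHom s).comp (E.comp (π : MvPolynomial (Fin 3) K →+* A))
        = (Polynomial.evalRingHom t).comp (E.comp (π : MvPolynomial (Fin 3) K →+* A)) := by
      apply MvPolynomial.ringHom_ext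
      · intro k
        simp [algHom_C, hEk]
      · intro j
        fin_cases j
        · simpa using h0
        · simpa using h1
        · simpa using h2
    have h3 : Polynomial.eval s (E (π w')) = Polynomial.eval t (E (π w')) :=
      congrArg (fun f : MvPolynomial (Fin 3) K →+* F => f w') hφ
    rw [hEw] at h3
    simp only [Polynomial.eval_add, Polynomial.eval_mul, Polynomial.eval_C, Polynomial.eval_X,
      add_right_inj] at h3
    exact mul_left_cancel₀ (fun h => hw1 (hi0 _ h)) h3

set_option synthInstance.maxHeartbeats 1000000 in
/-- Proposition: for odd `e₁ ≥ 3` and `a, b ∈ K*`, the quotient algebra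
`K[x₁,x₂,x₃]/(x₃² + (a·x₁^{e₁} + b·x₂²)·x₁)` admits no nonzero locally nilpotent
derivation. -/
theorem stmt19 {K : Type*} [Field K] [IsAlgClosed K] [CharZero K]
    (e₁ : ℕ) (he₁ : Odd e₁) (he₁' : 3 ≤ e₁) (a b : K) (ha : a ≠ 0) (hb : b ≠ 0)
    (R : MvPolynomial (Fin 3) K)
    (hR : R = X 2 ^ 2 + (C a * X 0 ^ e₁ + C b * X 1 ^ 2) * X 0)
    (D : Derivation K (MvPolynomial (Fin 3) K ⧸ Ideal.span {R})
        (MvPolynomial (Fin 3) K ⧸ Ideal.span {R}))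
    (hD : IsLND D) : D = 0 := by
  subst hR
  have hpr := lnd_irred e₁ (by omega) a b hb
  have hp : (Ideal.span {(X 2 ^ 2 + (C a * X 0 ^ e₁ + C b * X 1 ^ 2) * X 0 :
      MvPolynomial (Fin 3) K)}).IsPrime := (Ideal.span_singleton_prime hpr.ne_zero).2 hpr
  haveI := Ideal.Quotient.isDomain
    (Ideal.span {(X 2 ^ 2 + (C a * X 0 ^ e₁ + C b * X 1 ^ 2) * X 0 : MvPolynomial (Fin 3) K)})
  exact lnd_abs e₁ he₁ he₁' a b ha hb (Ideal.Quotient.mkₐ K _)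
    (Ideal.Quotient.mkₐ_surjective K _)
    (fun f => (Ideal.Quotient.eq_zero_iff_mem).trans Ideal.mem_span_singleton) D hD
end
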